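/- Let λ>0 and either 0<q<1<p<∞ or 1<q<p<∞, with r=pq/(p−q), and let v,w be non-negative measurable weights on (0,∞) with v^{p'} and w^q locally integrable. Define B_H=(∫_0^∞ (∫_0^t v^{p'})^{r/p'} (∫_t^∞ x^{−λq} w(x)^q dx)^{r/p} t^{−λq} w(t)^q dt)^{1/r} and B_{H*}=(∫_0^∞ (∫_t^∞ y^{−λp'} v(y)^{p'} dy)^{r/p'} (∫_0^t w^q)^{r/p} w(t)^q dt)^{1/r}. Then the Stieltjes-type operator S is bounded from L^p to L^q if and only if B_H+B_{H*}<∞; moreover there exist constants 0<c₁≤c₂<∞ depending only on p, q and λ such that c₁(B_H+B_{H*}) ≤ ‖S‖_{L^p→L^q} ≤ c₂(B_H+B_{H*}). -/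

import Mathlib

open MeasureTheory Set Filter Topology
open scoped ENNReal NNReal

noncomputable section

/-- The least constant `C` (possibly `∞`) such that `‖Sf‖_q ≤ C ‖f‖_p` for all measurable
`f ≥ 0`, where `Sf(x) = w(x) ∫_0^∞ f(y) v(y)/(x^λ + y^λ) dy` is the Stieltjes-type operator. -/
def SNorm (lam p q : ℝ) (v w : ℝ → ℝ) : ℝ≥0∞ :=
  sInf {c : ℝ≥0∞ | ∀ f : ℝ → ℝ, Measurable f → (∀ y, 0 ≤ f y) →
    (∫⁻ x in Ioi (0:ℝ), (ENNReal.ofReal (w x) * ∫⁻ y in Ioi (0:ℝ),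
        ENNReal.ofReal (f y) * ENNReal.ofReal (v y)
          / (ENNReal.ofReal (x ^ lam) + ENNReal.ofReal (y ^ lam))) ^ q) ^ (1/q)
      ≤ c * (∫⁻ y in Ioi (0:ℝ), ENNReal.ofReal (f y) ^ p) ^ (1/p)}

/-- `V₀(t) = ∫_0^t v^{p'}`. -/
def V0 (p' : ℝ) (v : ℝ → ℝ) (t : ℝ) : ℝ≥0∞ :=
  ∫⁻ y in Ioo (0:ℝ) t, ENNReal.ofReal (v y) ^ p'

/-- `𝒱_t(∞) = ∫_t^∞ y^{-λp'} v(y)^{p'} dy`. -/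
def Vinf (lam p' : ℝ) (v : ℝ → ℝ) (t : ℝ) : ℝ≥0∞ :=
  ∫⁻ y in Ioi t, (ENNReal.ofReal y) ^ (-(lam * p')) * ENNReal.ofReal (v y) ^ p'

/-- `W₀(t) = ∫_0^t w^q`. -/
def W0 (q : ℝ) (w : ℝ → ℝ) (t : ℝ) : ℝ≥0∞ :=
  ∫⁻ x in Ioo (0:ℝ) t, ENNReal.ofReal (w x) ^ q

/-- `𝒲_t(∞) = ∫_t^∞ x^{-λq} w(x)^q dx`. -/
def Winf (lam q : ℝ) (w : ℝ → ℝ) (t : ℝ) : ℝ≥0∞ :=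
  ∫⁻ x in Ioi t, (ENNReal.ofReal x) ^ (-(lam * q)) * ENNReal.ofReal (w x) ^ q

/-- `A_H(t) = (∫_0^t v^{p'})^{1/p'} (∫_t^∞ x^{-λq} w(x)^q dx)^{1/q}`. -/
def AH (lam p' q : ℝ) (v w : ℝ → ℝ) (t : ℝ) : ℝ≥0∞ :=
  (V0 p' v t) ^ (1/p') * (Winf lam q w t) ^ (1/q)

/-- `A_{H*}(t) = (∫_t^∞ y^{-λp'} v(y)^{p'} dy)^{1/p'} (∫_0^t w^q)^{1/q}`. -/
def AHs (lam p' q : ℝ) (v w : ℝ → ℝ) (t : ℝ) : ℝ≥0∞ :=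
  (Vinf lam p' v t) ^ (1/p') * (W0 q w t) ^ (1/q)

/-- `B_H = (∫_0^∞ V₀(t)^{r/p'} 𝒲_t(∞)^{r/p} t^{-λq} w(t)^q dt)^{1/r}`. -/
def BH (lam p p' q r : ℝ) (v w : ℝ → ℝ) : ℝ≥0∞ :=
  (∫⁻ t in Ioi (0:ℝ), (V0 p' v t) ^ (r/p') * (Winf lam q w t) ^ (r/p)
    * (ENNReal.ofReal t) ^ (-(lam * q)) * ENNReal.ofReal (w t) ^ q) ^ (1/r)

/-- `B_{H*} = (∫_0^∞ 𝒱_t(∞)^{r/p'} W₀(t)^{r/p} w(t)^q dt)^{1/r}`. -/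
def BHs (lam p p' q r : ℝ) (v w : ℝ → ℝ) : ℝ≥0∞ :=
  (∫⁻ t in Ioi (0:ℝ), (Vinf lam p' v t) ^ (r/p') * (W0 q w t) ^ (r/p)
    * ENNReal.ofReal (w t) ^ q) ^ (1/r)

lemma rpow_le_rpow_of_nonpos_exponent {x y : ℝ≥0∞} {z : ℝ} (hz : z ≤ 0) (h : x ≤ y) :
    y ^ z ≤ x ^ z := by
  have h' := ENNReal.inv_le_inv.2 (ENNReal.rpow_le_rpow h (neg_nonneg.2 hz))
  rwa [← ENNReal.rpow_neg, ← ENNReal.rpow_neg, neg_neg] at h'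

lemma rpow_sub_one_mul_self {x : ℝ≥0∞} (h0 : x ≠ 0) (htop : x ≠ ⊤) (s : ℝ) :
    x ^ (s - 1) * x = x ^ s := by
  conv_lhs => rw [← ENNReal.rpow_one x, ← ENNReal.rpow_mul]
  rw [← ENNReal.rpow_add _ _ h0 htop]
  simp

/-- A measurable transitive relation `R` all of whose sections are so evenly spread that, for every
absolutely continuous measure `ρ`, the function `y ↦ ρ {z | R z y}` is distributed at least as
widely as Lebesgue measure. Both `<` and `>` on `ℝ` have this property. -/
structure ContinuousOrder (R : ℝ → ℝ → Prop) : Prop where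
  trans : ∀ x y z, R x y → R y z → R x z
  measurable_rel : MeasurableSet {z : ℝ × ℝ | R z.1 z.2}
  measure_sublevel_le : ∀ ρ : Measure ℝ, ρ ≪ volume → ∀ s : ℝ≥0∞,
    ρ {y | ρ {z | R z y} ≤ s} ≤ s

lemma measure_le_of_cofinal (R : ℝ → ℝ → Prop) (htr : ∀ x y z, R x y → R y z → R x z)
    (htot : ∀ x y, R x y ∨ R y x ∨ x = y) (hdense : ∀ x y, R x y → ∃ a : ℚ, R x a ∧ R a y)
    (ρ : Measure ℝ) (hρ : ρ ≪ volume) (s : ℝ≥0∞) :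
    ρ {y | ρ {z | R z y} ≤ s} ≤ s := by
  set A := {y | ρ {z | R z y} ≤ s} with hA
  have hlow : ∀ x y, R x y → y ∈ A → x ∈ A := fun x y h hy =>
    (measure_mono fun z hz => htr _ _ _ hz h).trans hy
  set B := ⋃ a ∈ {a : ℚ | (a : ℝ) ∈ A}, {z | R z a} with hB
  have hsub : (A \ B).Subsingleton := by
    intro x hx y hy
    have key : ∀ x y, x ∈ A \ B → y ∈ A \ B → ¬ R x y := by
      intro x y hx hy h
      obtain ⟨a, hxa, hay⟩ := hdense x y h
      exact hx.2 (mem_biUnion (hlow _ _ hay hy.1) hxa)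
    rcases htot x y with h | h | h
    · exact absurd h (key _ _ hx hy)
    · exact absurd h (key _ _ hy hx)
    · exact h
  have h0 : ρ (A \ B) = 0 := hρ (hsub.measure_zero _)
  have hBs : ρ B ≤ s := by
    rw [hB, measure_biUnion_eq_iSup (to_countable _)]
    · exact iSup₂_le fun a ha => ha
    · intro a ha b hb
      rcases htot a b with h | h | h
      · exact ⟨b, hb, fun z hz => htr _ _ _ hz h, subset_rfl⟩
      · exact ⟨a, ha, subset_rfl, fun z hz => htr _ _ _ hz h⟩
      · exact ⟨a, ha, subset_rfl, by simp [Function.onFun, h]⟩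
  calc ρ A ≤ ρ (A \ B ∪ B) := measure_mono fun x hx => by
        by_cases h : x ∈ B
        · exact Or.inr h
        · exact Or.inl ⟨hx, h⟩
    _ ≤ ρ (A \ B) + ρ B := measure_union_le _ _
    _ ≤ s := by rw [h0, zero_add]; exact hBs

lemma continuousOrder_lt : ContinuousOrder (fun x y : ℝ => x < y) where
  trans _ _ _ := lt_trans
  measurable_rel := measurableSet_lt measurable_fst measurable_snd
  measure_sublevel_le := measure_le_of_cofinal _ (fun _ _ _ => lt_trans)
    (fun x y => by rcases lt_trichotomy x y with h | h | h <;> simp [h])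
    (fun _ _ h => exists_rat_btwn h)

lemma continuousOrder_gt : ContinuousOrder (fun x y : ℝ => y < x) where
  trans _ _ _ h h' := lt_trans h' h
  measurable_rel := measurableSet_lt measurable_snd measurable_fst
  measure_sublevel_le := measure_le_of_cofinal _ (fun _ _ _ h h' => lt_trans h' h)
    (fun x y => by rcases lt_trichotomy x y with h | h | h <;> simp [h])
    (fun _ _ h => (exists_rat_btwn h).imp fun _ h => h.symm)

namespace ContinuousOrder

variable {R : ℝ → ℝ → Prop}

lemma measurableSet_left (hR : ContinuousOrder R) (x : ℝ) : MeasurableSet {y | R y x} :=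
  (measurable_id.prodMk measurable_const : Measurable fun y : ℝ => (y, x)) hR.measurable_rel

lemma measurableSet_right (hR : ContinuousOrder R) (x : ℝ) : MeasurableSet {y | R x y} :=
  (measurable_const.prodMk measurable_id : Measurable fun y : ℝ => (x, y)) hR.measurable_rel

lemma measurable_left (hR : ContinuousOrder R) (ρ : Measure ℝ) [SFinite ρ] :
    Measurable fun x => ρ {y | R y x} :=
  measurable_measure_prodMk_right hR.measurable_rel

lemma measurable_right (hR : ContinuousOrder R) (ρ : Measure ℝ) [SFinite ρ] :
    Measurable fun x => ρ {y | R x y} :=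
  measurable_measure_prodMk_left hR.measurable_rel

lemma measurable_lintegral_left (hR : ContinuousOrder R) (g : ℝ → ℝ≥0∞) :
    Measurable fun x => ∫⁻ y in {y | R y x}, g y := by
  have h : ∀ x, ∫⁻ y in {y | R y x}, g y = (volume.withDensity g) {y | R y x} := fun x =>
    (withDensity_apply _ (hR.measurableSet_left x)).symm
  simp only [h]
  exact hR.measurable_left _

lemma measurable_lintegral_right (hR : ContinuousOrder R) (g : ℝ → ℝ≥0∞) :
    Measurable fun x => ∫⁻ y in {y | R x y}, g y := by
  have h : ∀ x, ∫⁻ y in {y | R x y}, g y = (volume.withDensity g) {y | R x y} := fun x =>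
    (withDensity_apply _ (hR.measurableSet_right x)).symm
  simp only [h]
  exact hR.measurable_right _

lemma ae_pos (hR : ContinuousOrder R) {ρ : Measure ℝ} (hρ : ρ ≪ volume) :
    ∀ᵐ x ∂ρ, ρ {y | R y x} ≠ 0 := by
  have h := hR.measure_sublevel_le ρ hρ 0
  simpa [ae_iff] using h

/-- Lower bound for the integral of a non-negative power of the distribution function. -/
lemma rpow_le_lintegral (hR : ContinuousOrder R) {ρ : Measure ℝ} [SFinite ρ] (hρ : ρ ≪ volume)
    {b : ℝ} (hb : 0 ≤ b) :
    ρ univ ^ (b + 1) ≤ 2 ^ (b + 1) * ∫⁻ x, (ρ {y | R y x}) ^ b ∂ρ := by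
  have hV := hR.measurable_left ρ
  have main : ∀ s : ℝ≥0∞, s ^ b * (ρ univ - s) ≤ ∫⁻ x, (ρ {y | R y x}) ^ b ∂ρ := by
    intro s
    have h1 : ρ univ - s ≤ ρ {x | s < ρ {y | R y x}} := by
      rw [tsub_le_iff_right]
      calc ρ univ ≤ ρ ({x | s < ρ {y | R y x}} ∪ {x | ρ {y | R y x} ≤ s}) :=
            measure_mono fun x _ => lt_or_ge s (ρ {y | R y x})
        _ ≤ _ := measure_union_le _ _
        _ ≤ _ := by gcongr; exact hR.measure_sublevel_le ρ hρ s
    calc s ^ b * (ρ univ - s) ≤ s ^ b * ρ {x | s < ρ {y | R y x}} := by gcongr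
      _ = ∫⁻ x in {x | s < ρ {y | R y x}}, s ^ b ∂ρ := by simp
      _ ≤ ∫⁻ x in {x | s < ρ {y | R y x}}, (ρ {y | R y x}) ^ b ∂ρ := by
          refine setLIntegral_mono' (measurableSet_lt measurable_const hV) fun x hx => ?_
          gcongr
          exact le_of_lt hx
      _ ≤ _ := setLIntegral_le_lintegral _ _
  by_cases htop : ρ univ = ⊤
  · have h1 := main 1
    simp only [htop, ENNReal.one_rpow, one_mul, ENNReal.top_sub ENNReal.one_ne_top,
      top_le_iff] at h1
    rw [h1, ENNReal.mul_top]
    · exact le_top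
    · simp [ENNReal.rpow_eq_zero_iff]
  · have h1 := main (ρ univ / 2)
    rw [ENNReal.sub_half htop] at h1
    calc ρ univ ^ (b + 1) = (2 * (ρ univ / 2)) ^ (b + 1) := by
          rw [ENNReal.mul_div_cancel (by simp) (by simp)]
      _ = 2 ^ (b + 1) * (ρ univ / 2) ^ (b + 1) := ENNReal.mul_rpow_of_nonneg _ _ (by linarith)
      _ = 2 ^ (b + 1) * ((ρ univ / 2) ^ b * (ρ univ / 2)) := by
          rw [ENNReal.rpow_add_of_nonneg (x := ρ univ / 2) _ _ hb zero_le_one, ENNReal.rpow_one]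
      _ ≤ _ := by gcongr

/-- Lower bound for the integral of a power of the distribution function, finite measures. -/
lemma rpow_le_lintegral_of_finite (hR : ContinuousOrder R) {ρ : Measure ℝ} [IsFiniteMeasure ρ]
    (hρ : ρ ≪ volume) {s : ℝ} (hs : 0 < s) :
    ρ univ ^ s ≤ 2 ^ s * ∫⁻ x, (ρ {y | R y x}) ^ (s - 1) ∂ρ := by
  rcases le_or_gt 1 s with h | h
  · simpa using hR.rpow_le_lintegral hρ (sub_nonneg.2 h)
  · by_cases h0 : ρ univ = 0
    · simp [h0, hs]
    calc ρ univ ^ s = 1 * (ρ univ ^ (s - 1) * ρ univ) := by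
          rw [one_mul, rpow_sub_one_mul_self h0 (measure_ne_top _ _)]
      _ = 1 * ∫⁻ x, (ρ univ) ^ (s - 1) ∂ρ := by simp
      _ ≤ _ := by
          refine mul_le_mul' (ENNReal.one_le_rpow (by norm_num) hs) (lintegral_mono fun x => ?_)
          exact rpow_le_rpow_of_nonpos_exponent (by linarith) (measure_mono (subset_univ _))

/-- Upper bound for the integral of a power of the distribution function. -/
lemma lintegral_rpow_le (hR : ContinuousOrder R) {s : ℝ} (hs : 0 < s) :
    ∃ C : ℝ≥0∞, C ≠ ⊤ ∧ ∀ (ρ : Measure ℝ) [IsFiniteMeasure ρ], ρ ≪ volume →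
      ∫⁻ x, (ρ {y | R y x}) ^ (s - 1) ∂ρ ≤ C * ρ univ ^ s := by
  rcases le_or_gt 1 s with h | h
  · refine ⟨1, by simp, fun ρ _ hρ => ?_⟩
    calc ∫⁻ x, (ρ {y | R y x}) ^ (s - 1) ∂ρ ≤ ∫⁻ x, (ρ univ) ^ (s - 1) ∂ρ := by
          refine lintegral_mono fun x => ?_
          exact ENNReal.rpow_le_rpow (measure_mono (subset_univ _)) (by linarith)
      _ = ρ univ ^ (s - 1) * ρ univ ^ (1 : ℝ) := by simp
      _ = _ := by rw [← ENNReal.rpow_add_of_nonneg _ _ (by linarith) (by simp)]; simp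
  · refine ⟨(2⁻¹ : ℝ≥0∞) ^ (s - 1) * (1 - (2⁻¹ : ℝ≥0∞) ^ s)⁻¹, ?_, fun ρ _ hρ => ?_⟩
    · refine ENNReal.mul_ne_top ?_ ?_
      · simp [ENNReal.rpow_eq_top_iff]
      · simp only [ne_eq, ENNReal.inv_eq_top, tsub_eq_zero_iff_le, not_le]
        exact ENNReal.rpow_lt_one (by simp) hs
    set M := ρ univ with hM
    have hMtop : M ≠ ⊤ := measure_ne_top _ _
    by_cases h0 : M = 0
    · rw [Measure.measure_univ_eq_zero.1 h0]; simp
    have hhalf : ∀ n : ℕ, ((2⁻¹ : ℝ≥0∞) ^ n * M) ≠ 0 := fun n => by simp [h0]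
    have hhalf' : ∀ n : ℕ, ((2⁻¹ : ℝ≥0∞) ^ n * M) ≠ ⊤ := fun n =>
      ENNReal.mul_ne_top (by simp) hMtop
    have hpt : ∀ᵐ x ∂ρ, (ρ {y | R y x}) ^ (s - 1) ≤ ∑' n : ℕ,
        {x | ρ {y | R y x} ≤ (2⁻¹ : ℝ≥0∞) ^ n * M}.indicator
          (fun _ => ((2⁻¹ : ℝ≥0∞) ^ (n + 1) * M) ^ (s - 1)) x := by
      filter_upwards [hR.ae_pos hρ] with x hx
      have hxtop : ρ {y | R y x} ≠ ⊤ := measure_ne_top _ _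
      have hle : ρ {y | R y x} ≤ M := measure_mono (subset_univ _)
      have hMpos := ENNReal.toReal_pos h0 hMtop
      obtain ⟨n, hn1, hn2⟩ := exists_nat_pow_near_of_lt_one
        (x := (ρ {y | R y x}).toReal / M.toReal) (y := (2⁻¹ : ℝ))
        (div_pos (ENNReal.toReal_pos hx hxtop) hMpos)
        (div_le_one_of_le₀ (ENNReal.toReal_mono hMtop hle) hMpos.le) (by norm_num) (by norm_num)
      rw [lt_div_iff₀ hMpos] at hn1
      rw [div_le_iff₀ hMpos] at hn2
      have e1 : (2⁻¹ : ℝ≥0∞) ^ (n + 1) * M ≤ ρ {y | R y x} := by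
        rw [← ENNReal.toReal_le_toReal (hhalf' _) hxtop]
        simpa using hn1.le
      have e2 : ρ {y | R y x} ≤ (2⁻¹ : ℝ≥0∞) ^ n * M := by
        rw [← ENNReal.toReal_le_toReal hxtop (hhalf' _)]
        simpa using hn2
      refine le_trans ?_ (ENNReal.le_tsum n)
      rw [indicator_of_mem (by exact e2)]
      exact rpow_le_rpow_of_nonpos_exponent (by linarith) e1
    calc ∫⁻ x, (ρ {y | R y x}) ^ (s - 1) ∂ρ ≤ _ := lintegral_mono_ae hpt
      _ = ∑' n : ℕ, ((2⁻¹ : ℝ≥0∞) ^ (n + 1) * M) ^ (s - 1)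
            * ρ {x | ρ {y | R y x} ≤ (2⁻¹ : ℝ≥0∞) ^ n * M} := by
          have hms : ∀ n : ℕ, MeasurableSet {x | ρ {y | R y x} ≤ (2⁻¹ : ℝ≥0∞) ^ n * M} :=
            fun n => measurableSet_le (hR.measurable_left ρ) measurable_const
          rw [lintegral_tsum fun n => (measurable_const.indicator (hms n)).aemeasurable]
          exact tsum_congr fun n => lintegral_indicator_const (hms n) _
      _ ≤ ∑' n : ℕ, ((2⁻¹ : ℝ≥0∞) ^ (n + 1) * M) ^ (s - 1) * ((2⁻¹ : ℝ≥0∞) ^ n * M) := by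
          gcongr with n
          exact hR.measure_sublevel_le ρ hρ _
      _ = ∑' n : ℕ, (2⁻¹ : ℝ≥0∞) ^ (s - 1) * M ^ s * ((2⁻¹ : ℝ≥0∞) ^ s) ^ n := by
          refine tsum_congr fun n => ?_
          have e : (2⁻¹ : ℝ≥0∞) ^ (n + 1) * M = 2⁻¹ * ((2⁻¹ : ℝ≥0∞) ^ n * M) := by ring
          rw [e, ENNReal.mul_rpow_of_ne_top (by simp) (hhalf' n), mul_assoc]
          rw [rpow_sub_one_mul_self (hhalf n) (hhalf' n),
            ENNReal.mul_rpow_of_nonneg _ _ hs.le, ← ENNReal.rpow_natCast, ← ENNReal.rpow_natCast,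
            ← ENNReal.rpow_mul, ← ENNReal.rpow_mul, mul_comm s]
          ring
      _ = _ := by
          rw [ENNReal.tsum_mul_left, ENNReal.tsum_geometric]; ring

end ContinuousOrder

/-- The relations between the exponents of the Hardy inequality below the diagonal. -/
lemma hardy_exponents {p q p' r : ℝ} (hp : 1 < p) (hq : 0 < q) (hqp : q < p)
    (hp' : p' = p / (p - 1)) (hr : r = p * q / (p - q)) :
    0 < p' ∧ 0 < r ∧ r / p + 1 = r / q ∧ p.HolderConjugate p' ∧
      (p / q).HolderConjugate (r / q) := by
  have h1 : 0 < p - 1 := by linarith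
  have h2 : 0 < p - q := by linarith
  have h3 : 0 < p := by linarith
  refine ⟨by rw [hp']; positivity, by rw [hr]; positivity, ?_, ?_, ?_⟩
  · rw [hr]; field_simp; ring
  · rw [hp']; exact Real.HolderConjugate.conjExponent hp
  · rw [Real.holderConjugate_iff]
    refine ⟨(one_lt_div hq).2 hqp, ?_⟩
    rw [hr]; field_simp; ring

lemma tsum_rpow_mul_rpow_le {ι : Type*} {s t : ℝ} (hs : 0 < s) (ht : 0 < t)
    (hst : (s⁻¹).HolderConjugate t⁻¹) (a b : ι → ℝ≥0∞) :
    ∑' i, a i ^ s * b i ^ t ≤ (∑' i, a i) ^ s * (∑' i, b i) ^ t := by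
  let _ : MeasurableSpace ι := ⊤
  have h := ENNReal.lintegral_mul_le_Lp_mul_Lq (Measure.count : Measure ι) hst
    (f := fun i => a i ^ s) (g := fun i => b i ^ t)
    (measurable_from_top.aemeasurable) (measurable_from_top.aemeasurable)
  simpa [lintegral_count, ← ENNReal.rpow_mul, mul_inv_cancel₀ hs.ne', mul_inv_cancel₀ ht.ne',
    Pi.mul_apply] using h

namespace ContinuousOrder

variable {R : ℝ → ℝ → Prop}

lemma rpow_mul_measure_le (hR' : ContinuousOrder fun x y => R y x) {ν : Measure ℝ} [SFinite ν]
    (hν : ν ≪ volume) {q p' r b : ℝ} (hq : 0 < q) (hr : 0 < r) (hb : 0 ≤ b)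
    (hbr : b + 1 = r / q) {E : Set ℝ} (hE : MeasurableSet E) {V : ℝ → ℝ≥0∞} (hV : Measurable V)
    {T A : ℝ≥0∞} (hT : ∀ x ∈ E, T ≤ A * V x ^ (1 / p')) :
    T ^ q * ν E ≤ 2 * A ^ q * (∫⁻ x in E, V x ^ (r / p') * (ν {y | R x y}) ^ b ∂ν) ^ (q / r) := by
  have hW := hR'.measurable_left ν
  have h1 : T ^ r * ν E ^ (b + 1) ≤ 2 ^ (b + 1) * A ^ r *
      ∫⁻ x in E, V x ^ (r / p') * (ν {y | R x y}) ^ b ∂ν := by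
    have h := hR'.rpow_le_lintegral (ρ := ν.restrict E)
      (Measure.restrict_le_self.absolutelyContinuous.trans hν) hb
    rw [Measure.restrict_apply_univ] at h
    calc T ^ r * ν E ^ (b + 1)
        ≤ T ^ r * (2 ^ (b + 1) * ∫⁻ x in E, (ν {y | R x y}) ^ b ∂ν) := by
          gcongr
          refine h.trans ?_
          gcongr
          exact Measure.restrict_le_self
      _ = 2 ^ (b + 1) * ∫⁻ x in E, T ^ r * (ν {y | R x y}) ^ b ∂ν := by
          rw [lintegral_const_mul _ (hW.pow_const b)]; ring
      _ ≤ 2 ^ (b + 1) * ∫⁻ x in E, A ^ r * (V x ^ (r / p') * (ν {y | R x y}) ^ b) ∂ν := by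
          gcongr 2 ^ (b + 1) * ?_
          refine setLIntegral_mono' hE fun x hx => ?_
          rw [← mul_assoc]
          gcongr
          calc T ^ r ≤ (A * V x ^ (1 / p')) ^ r := by gcongr; exact hT x hx
            _ = _ := by
              rw [ENNReal.mul_rpow_of_nonneg _ _ hr.le, ← ENNReal.rpow_mul]; ring_nf
      _ = _ := by
          have hm : Measurable fun x => V x ^ (r / p') * ν {y | R x y} ^ b :=
            (hV.pow_const _).mul (hW.pow_const b)
          rw [lintegral_const_mul _ hm]; ring
  have hqr : 0 < q / r := by positivity
  have e1 : r * (q / r) = q := by field_simp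
  have e2 : (b + 1) * (q / r) = 1 := by rw [hbr]; field_simp
  have h2 := ENNReal.rpow_le_rpow h1 hqr.le
  rwa [ENNReal.mul_rpow_of_nonneg _ _ hqr.le, ENNReal.mul_rpow_of_nonneg _ _ hqr.le,
    ENNReal.mul_rpow_of_nonneg _ _ hqr.le, ← ENNReal.rpow_mul, ← ENNReal.rpow_mul,
    ← ENNReal.rpow_mul, ← ENNReal.rpow_mul, e1, e2, ENNReal.rpow_one, ENNReal.rpow_one] at h2

/-- Points of a dyadic level set of the primitive of `f * k` see enough mass of `f` on two
adjacent level sets. -/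
lemma level_le (hR : ContinuousOrder R) {p p' : ℝ} (hpp : p.HolderConjugate p')
    {f k : ℝ → ℝ≥0∞} (hf : Measurable f) (hk : Measurable k) {s : ℝ≥0∞} (hs : s ≠ ⊤) {x : ℝ}
    (hx : ∫⁻ y in {y | R y x}, f y * k y ∈ Ioc (2 * s) (4 * s)) :
    4 * s ≤ 4 * (∫⁻ z in {z | ∫⁻ y in {y | R y z}, f y * k y ∈ Ioc s (4 * s)}, f z ^ p) ^ (1 / p)
      * (∫⁻ y in {y | R y x}, k y ^ p') ^ (1 / p') := by
  set ρ := (volume : Measure ℝ).withDensity (fun y => f y * k y) with hρ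
  have hfk : Measurable fun y => f y * k y := hf.mul hk
  have hac : ρ ≪ volume := withDensity_absolutelyContinuous _ _
  have hF : ∀ z, ∫⁻ y in {y | R y z}, f y * k y = ρ {y | R y z} := fun z =>
    (withDensity_apply _ (hR.measurableSet_left z)).symm
  simp only [hF] at hx ⊢
  set D := {z | ρ {y | R y z} ∈ Ioc s (4 * s)} with hD
  have hDm : MeasurableSet D := hR.measurable_left ρ measurableSet_Ioc
  have h1 : 2 * s ≤ s + ρ (D ∩ {y | R y x}) := by
    calc 2 * s ≤ ρ {y | R y x} := hx.1.le
      _ ≤ ρ ({y | ρ {z | R z y} ≤ s} ∪ D ∩ {y | R y x}) := by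
          refine measure_mono fun y hy => ?_
          rcases le_or_gt (ρ {z | R z y}) s with h | h
          · exact Or.inl h
          · refine Or.inr ⟨⟨h, le_trans (measure_mono fun z hz => ?_) hx.2⟩, hy⟩
            exact hR.trans _ _ _ hz hy
      _ ≤ _ := measure_union_le _ _
      _ ≤ _ := by gcongr; exact hR.measure_sublevel_le ρ hac s
  rw [two_mul] at h1
  have h2 : s ≤ ρ (D ∩ {y | R y x}) := (ENNReal.add_le_add_iff_left hs).1 h1
  rw [mul_assoc]
  gcongr
  calc s ≤ ρ (D ∩ {y | R y x}) := h2
    _ = ∫⁻ y in D ∩ {y | R y x}, f y * k y :=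
        withDensity_apply _ (hDm.inter (hR.measurableSet_left x))
    _ ≤ _ := ENNReal.lintegral_mul_le_Lp_mul_Lq _ hpp hf.aemeasurable hk.aemeasurable
    _ ≤ _ := by
        have hp := hpp.pos
        have hp' := hpp.symm.pos
        gcongr
        · exact inter_subset_left
        · exact inter_subset_right

/-- The sum of the integrals over the dyadic level sets of a function. -/
lemma tsum_lintegral_level_le (ν : Measure ℝ) {F : ℝ → ℝ≥0∞} (hF : Measurable F)
    (g : ℝ → ℝ≥0∞) :
    ∑' j : ℤ, ∫⁻ x in {x | F x ∈ Ioc ((2 : ℝ≥0∞) ^ j) (2 ^ (j + 1))}, g x ∂ν ≤ ∫⁻ x, g x ∂ν := by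
  have hmono : Monotone fun j : ℤ => (2 : ℝ≥0∞) ^ j := fun i j h =>
    ENNReal.zpow_le_of_le (by norm_num) h
  have hdis := hmono.pairwise_disjoint_on_Ioc_succ
  have hm : ∀ j : ℤ, MeasurableSet {x | F x ∈ Ioc ((2 : ℝ≥0∞) ^ j) (2 ^ (j + 1))} :=
    fun j => hF measurableSet_Ioc
  rw [← lintegral_iUnion hm]
  · exact setLIntegral_le_lintegral _ _
  · intro i j hij
    exact (hdis hij).preimage F

/-- The weighted Hardy inequality below the diagonal. -/
theorem hardy_le (hR : ContinuousOrder R) (hR' : ContinuousOrder fun x y => R y x)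
    {p q p' r : ℝ} (hp : 1 < p) (hq : 0 < q) (hqp : q < p)
    (hp' : p' = p / (p - 1)) (hr : r = p * q / (p - q)) {f k u : ℝ → ℝ≥0∞}
    (hf : Measurable f) (hk : Measurable k) (hu : Measurable u) :
    ∫⁻ x, (∫⁻ y in {y | R y x}, f y * k y) ^ q * u x ≤
      2 * 4 ^ q * 2 ^ (q / p) *
      (∫⁻ x, (∫⁻ y in {y | R y x}, k y ^ p') ^ (r / p') * (∫⁻ y in {y | R x y}, u y) ^ (r / p)
        * u x) ^ (q / r) * (∫⁻ y, f y ^ p) ^ (q / p) := by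
  obtain ⟨hp'0, hr0, hbr, hpp, hpr⟩ := hardy_exponents hp hq hqp hp' hr
  have hp0 : 0 < p := by linarith
  set ν := (volume : Measure ℝ).withDensity u with hνdef
  set κ := (volume : Measure ℝ).withDensity (fun y => k y ^ p') with hκdef
  have hν : ν ≪ volume := withDensity_absolutelyContinuous _ _
  have hV : ∀ x, ∫⁻ y in {y | R y x}, k y ^ p' = κ {y | R y x} := fun z =>
    (withDensity_apply _ (hR.measurableSet_left z)).symm
  have hW : ∀ x, ∫⁻ y in {y | R x y}, u y = ν {y | R x y} := fun z =>
    (withDensity_apply _ (hR.measurableSet_right z)).symm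
  have hVm := hR.measurable_left κ
  have hWm := hR.measurable_right ν
  have hFm : Measurable fun x => ∫⁻ y in {y | R y x}, f y * k y :=
    hR.measurable_lintegral_left _
  have hint : ∀ g : ℝ → ℝ≥0∞, Measurable g → ∫⁻ x, g x * u x = ∫⁻ x, g x ∂ν := fun g hg => by
    rw [hνdef, lintegral_withDensity_eq_lintegral_mul _ hu hg]
    simp only [Pi.mul_apply, mul_comm]
  rw [hint _ (hFm.pow_const q)]
  simp only [hV, hW]
  set G : ℝ → ℝ≥0∞ := fun x => κ {y | R y x} ^ (r / p') * ν {y | R x y} ^ (r / p) with hG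
  have hGm : Measurable G := (hVm.pow_const _).mul (hWm.pow_const _)
  rw [hint G hGm]
  set F : ℝ → ℝ≥0∞ := fun x => ∫⁻ y in {y | R y x}, f y * k y with hF
  have hWpos : ∀ᵐ x ∂ν, ν {y | R x y} ≠ 0 := hR'.ae_pos hν
  have hHolder : ∀ x, F x ≤ (∫⁻ y, f y ^ p) ^ (1 / p) * (κ {y | R y x}) ^ (1 / p') := by
    intro x
    refine (ENNReal.lintegral_mul_le_Lp_mul_Lq _ hpp hf.aemeasurable hk.aemeasurable).trans ?_
    rw [hV]
    gcongr
    exact Measure.restrict_le_self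
  have hzero : (∀ᵐ x ∂ν, F x = 0) → ∫⁻ x, F x ^ q ∂ν = 0 := fun h => by
    rw [lintegral_congr_ae (g := fun _ => 0)]
    · simp
    · filter_upwards [h] with x hx
      simp [hx, hq]
  by_cases hf0 : ∫⁻ y, f y ^ p = 0
  · rw [hzero (ae_of_all _ fun x => by simpa [hf0, hp0] using hHolder x)]
    exact zero_le
  by_cases hI0 : ∫⁻ x, G x ∂ν = 0
  · rw [hzero]
    · exact zero_le
    · rw [lintegral_eq_zero_iff hGm] at hI0
      filter_upwards [hI0, hWpos] with x hx hWx
      have hVx : κ {y | R y x} = 0 := by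
        simp only [hG, Pi.zero_apply, mul_eq_zero, ENNReal.rpow_eq_zero_iff] at hx
        have hrp' : 0 < r / p' := by positivity
        have hrp : 0 < r / p := by positivity
        rcases hx with (h | h) | (h | h)
        · exact h.1
        · linarith [h.2]
        · exact absurd h.1 hWx
        · linarith [h.2]
      rw [← hV, lintegral_eq_zero_iff (hk.pow_const _)] at hVx
      rw [hF]
      simp only
      have hfk : Measurable fun y => f y * k y := hf.mul hk
      rw [lintegral_eq_zero_iff hfk]
      filter_upwards [hVx] with y hy
      have : k y = 0 := by simpa [hp'0, hp'0.not_gt] using hy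
      simp [this]
  by_cases hftop : ∫⁻ y, f y ^ p = ⊤
  · rw [hftop, ENNReal.top_rpow_of_pos (by positivity), ENNReal.mul_top]
    · exact le_top
    · have : 0 < q / r := by positivity
      simp [hI0, this.le, ENNReal.rpow_eq_zero_iff]
  by_cases hItop : ∫⁻ x, G x ∂ν = ⊤
  · rw [hItop, ENNReal.top_rpow_of_pos (by positivity), ENNReal.mul_top, ENNReal.top_mul]
    · exact le_top
    · have : 0 < q / p := by positivity
      simp [hf0, this.le, ENNReal.rpow_eq_zero_iff]
    · simp [ENNReal.rpow_eq_zero_iff]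
  have hfin : ∀ᵐ x ∂ν, F x ≠ ⊤ := by
    filter_upwards [ae_lt_top hGm hItop, hWpos] with x hx hWx
    have hVx : κ {y | R y x} ≠ ⊤ := by
      intro h
      simp only [hG, h] at hx
      rw [ENNReal.top_rpow_of_pos (by positivity), ENNReal.top_mul] at hx
      · exact lt_irrefl _ hx
      · have : 0 < r / p := by positivity
        simp [ENNReal.rpow_eq_zero_iff, hWx, this.le]
    refine ne_top_of_le_ne_top ?_ (hHolder x)
    exact ENNReal.mul_ne_top (ENNReal.rpow_ne_top_of_nonneg (by positivity) hftop)
      (ENNReal.rpow_ne_top_of_nonneg (by positivity) hVx)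
  set E : ℤ → Set ℝ := fun j => {x | F x ∈ Ioc ((2 : ℝ≥0∞) ^ j) (2 ^ (j + 1))} with hE
  have hEm : ∀ j, MeasurableSet (E j) := fun j => hFm measurableSet_Ioc
  set e : ℤ → ℝ≥0∞ := fun j => ∫⁻ x in E j, f x ^ p with he
  have hz : ∀ j : ℤ, (2 : ℝ≥0∞) ^ (j + 1) = 2 * 2 ^ j := fun j => by
    rw [ENNReal.zpow_add (by simp) (by simp), zpow_one, mul_comm]
  have hz' : ∀ j : ℤ, (2 : ℝ≥0∞) ^ (j + 1) = 4 * 2 ^ (j - 1) := fun j => by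
    rw [show j + 1 = (j - 1) + 1 + 1 by ring, hz, hz, ← mul_assoc]; norm_num
  have hz'' : ∀ j : ℤ, (2 : ℝ≥0∞) ^ j = 2 * 2 ^ (j - 1) := fun j => by
    rw [← hz, sub_add_cancel]
  have hlevel : ∀ j, ∫⁻ x in E j, F x ^ q ∂ν ≤
      2 * 4 ^ q * ((e (j - 1) + e j) ^ (q / p) * (∫⁻ x in E j, G x ∂ν) ^ (q / r)) := by
    intro j
    have hT : ∀ x ∈ E j, (2 : ℝ≥0∞) ^ (j + 1) ≤
        4 * (e (j - 1) + e j) ^ (1 / p) * κ {y | R y x} ^ (1 / p') := by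
      intro x hx
      have hx' : ∫⁻ y in {y | R y x}, f y * k y
          ∈ Ioc (2 * (2 : ℝ≥0∞) ^ (j - 1)) (4 * 2 ^ (j - 1)) := by
        rw [← hz', ← hz'']; exact hx
      have h := hR.level_le hpp hf hk (ENNReal.zpow_ne_top (by simp) (by simp) _) hx'
      rw [hz', ← hV]
      refine h.trans ?_
      gcongr
      refine le_trans (lintegral_mono_set (t := E (j - 1) ∪ E j) ?_) (lintegral_union_le _ _ _)
      intro z hz
      simp only [hE, mem_union, mem_ofPred_eq, mem_Ioc, sub_add_cancel] at hz ⊢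
      rcases le_or_gt (F z) (2 ^ j) with h | h
      · exact Or.inl ⟨hz.1, h⟩
      · exact Or.inr ⟨h, by rw [hz']; exact hz.2⟩
    calc ∫⁻ x in E j, F x ^ q ∂ν ≤ ∫⁻ x in E j, ((2 : ℝ≥0∞) ^ (j + 1)) ^ q ∂ν :=
          setLIntegral_mono' (hEm j) fun x hx => by gcongr; exact hx.2
      _ = ((2 : ℝ≥0∞) ^ (j + 1)) ^ q * ν (E j) := by simp
      _ ≤ _ := hR'.rpow_mul_measure_le hν hq hr0 (by positivity) hbr (hEm j) hVm hT
      _ = _ := by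
          rw [ENNReal.mul_rpow_of_nonneg _ _ hq.le, ← ENNReal.rpow_mul, one_div_mul_eq_div]
          ring
  have hsum : ∫⁻ x, F x ^ q ∂ν ≤ ∑' j, ∫⁻ x in E j, F x ^ q ∂ν := by
    refine le_trans ?_ (lintegral_iUnion_le _ _)
    rw [← lintegral_indicator (MeasurableSet.iUnion hEm)]
    refine lintegral_mono_ae ?_
    filter_upwards [hfin] with x hx
    by_cases h0 : F x = 0
    · simp [h0, hq]
    · rw [indicator_of_mem]
      obtain ⟨j, hj⟩ := ENNReal.exists_mem_Ioc_zpow h0 hx (y := 2) (by norm_num) (by simp)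
      exact mem_iUnion.2 ⟨j, hj⟩
  have hea : ∑' j, (e (j - 1) + e j) ≤ 2 * ∫⁻ y, f y ^ p := by
    have h := tsum_lintegral_level_le volume hFm (fun y => f y ^ p)
    rw [ENNReal.tsum_add, two_mul]
    refine add_le_add ?_ h
    exact ((Equiv.subRight (1 : ℤ)).tsum_eq e).trans_le h
  have hGa : ∑' j, ∫⁻ x in E j, G x ∂ν ≤ ∫⁻ x, G x ∂ν := tsum_lintegral_level_le ν hFm G
  calc ∫⁻ x, F x ^ q ∂ν ≤ ∑' j, ∫⁻ x in E j, F x ^ q ∂ν := hsum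
    _ ≤ ∑' j, 2 * 4 ^ q * ((e (j - 1) + e j) ^ (q / p) * (∫⁻ x in E j, G x ∂ν) ^ (q / r)) :=
        ENNReal.tsum_le_tsum hlevel
    _ ≤ 2 * 4 ^ q * ((∑' j, (e (j - 1) + e j)) ^ (q / p)
          * (∑' j, ∫⁻ x in E j, G x ∂ν) ^ (q / r)) := by
        rw [ENNReal.tsum_mul_left]
        gcongr
        exact tsum_rpow_mul_rpow_le (by positivity) (by positivity)
          (by rwa [inv_div, inv_div]) _ _
    _ ≤ 2 * 4 ^ q * ((2 * ∫⁻ y, f y ^ p) ^ (q / p) * (∫⁻ x, G x ∂ν) ^ (q / r)) := by gcongr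
    _ = _ := by
        rw [ENNReal.mul_rpow_of_nonneg _ _ (by positivity)]; ring

end ContinuousOrder

lemma iSup_mul_iSup_le_of_monotone {f g : ℕ → ℝ≥0∞} (hf : Monotone f) (hg : Monotone g) :
    (⨆ n, f n) * (⨆ n, g n) ≤ ⨆ n, f n * g n := by
  rw [ENNReal.iSup_mul]
  refine iSup_le fun i => ?_
  rw [ENNReal.mul_iSup]
  refine iSup_le fun j => le_iSup_of_le (max i j) ?_
  exact mul_le_mul' (hf (le_max_left _ _)) (hg (le_max_right _ _))

lemma iSup_rpow_eq (f : ℕ → ℝ≥0∞) {a : ℝ} (ha : 0 < a) : (⨆ n, f n) ^ a = ⨆ n, f n ^ a :=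
  (ENNReal.orderIsoRpow a ha).map_iSup f

lemma iSup_indicator_eq {A : ℕ → Set ℝ} (hA : ∀ x, ∃ n, x ∈ A n) (g : ℝ → ℝ≥0∞) (x : ℝ) :
    ⨆ n, (A n).indicator g x = g x := by
  refine le_antisymm (iSup_le fun n => indicator_le_self _ _ _) ?_
  obtain ⟨n, hn⟩ := hA x
  exact le_iSup_of_le n (by rw [indicator_of_mem hn])

lemma iSup_lintegral_indicator {A : ℕ → Set ℝ} (hAm : ∀ n, MeasurableSet (A n)) (hmono : Monotone A)
    (hA : ∀ x, ∃ n, x ∈ A n) {g : ℝ → ℝ≥0∞} (hg : Measurable g) (μ : Measure ℝ) :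
    ⨆ n, ∫⁻ x, (A n).indicator g x ∂μ = ∫⁻ x, g x ∂μ := by
  rw [← lintegral_iSup (fun n => hg.indicator (hAm n))
    (fun m n h x => indicator_le_indicator_of_subset (hmono h) (fun _ => zero_le) x)]
  simp only [iSup_indicator_eq hA]

namespace ContinuousOrder

variable {R : ℝ → ℝ → Prop}

lemma lintegral_restrict_section (hR : ContinuousOrder R) (κ : Measure ℝ) (x s : ℝ) :
    ∫⁻ y, ((κ.restrict {y | R y x}) {z | R z y}) ^ s ∂(κ.restrict {y | R y x})
      = ∫⁻ y in {y | R y x}, (κ {z | R z y}) ^ s ∂κ := by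
  refine setLIntegral_congr_fun (hR.measurableSet_left x) fun y hy => ?_
  rw [Measure.restrict_apply (hR.measurableSet_left y), inter_eq_left.2]
  exact fun z hz => hR.trans _ _ _ hz hy

/-- Necessity of the integral condition for Hardy's inequality below the diagonal, for
weights of finite total mass. -/
theorem hardy_ge_of_finite (hR : ContinuousOrder R) (hR' : ContinuousOrder fun x y => R y x)
    {p q p' r : ℝ} (hp : 1 < p) (hq : 0 < q) (hqp : q < p)
    (hp' : p' = p / (p - 1)) (hr : r = p * q / (p - q)) :
    ∃ C : ℝ≥0∞, C ≠ ⊤ ∧ ∀ k u : ℝ → ℝ≥0∞, Measurable k → Measurable u →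
      ∫⁻ y, k y ^ p' ≠ ⊤ → ∫⁻ y, u y ≠ ⊤ → ∀ c : ℝ≥0∞,
      (∀ f : ℝ → ℝ≥0∞, Measurable f → ∫⁻ y, f y ^ p ≠ ⊤ →
        ∫⁻ x, (∫⁻ y in {y | R y x}, f y * k y) ^ q * u x ≤ c * (∫⁻ y, f y ^ p) ^ (q / p)) →
      (∫⁻ x, (∫⁻ y in {y | R y x}, k y ^ p') ^ (r / p') * (∫⁻ y in {y | R x y}, u y) ^ (r / p)
        * u x) ^ (q / r) ≤ C * c := by
  obtain ⟨hp'0, hr0, hbr, hpp, hpr⟩ := hardy_exponents hp hq hqp hp' hr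
  have hp0 : 0 < p := by linarith
  obtain ⟨C₂, hC₂, hup⟩ := hR.lintegral_rpow_le (s := r / p') (by positivity)
  refine ⟨2 ^ (r / p') * (2 ^ (r / p + 1) * C₂) ^ (q / p), ?_, ?_⟩
  · refine ENNReal.mul_ne_top ?_ (ENNReal.rpow_ne_top_of_nonneg (by positivity) ?_)
    · exact ENNReal.rpow_ne_top_of_nonneg (by positivity) (by simp)
    · exact ENNReal.mul_ne_top (ENNReal.rpow_ne_top_of_nonneg (by positivity) (by simp)) hC₂
  intro k u hk hu hkfin hufin c hc
  set ν := (volume : Measure ℝ).withDensity u with hνdef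
  set κ := (volume : Measure ℝ).withDensity (fun y => k y ^ p') with hκdef
  have hkp : Measurable fun y => k y ^ p' := hk.pow_const _
  have : IsFiniteMeasure ν := isFiniteMeasure_withDensity hufin
  have : IsFiniteMeasure κ := isFiniteMeasure_withDensity hkfin
  have hν : ν ≪ volume := withDensity_absolutelyContinuous _ _
  have hκ : κ ≪ volume := withDensity_absolutelyContinuous _ _
  have hV : ∀ x, ∫⁻ y in {y | R y x}, k y ^ p' = κ {y | R y x} := fun z =>
    (withDensity_apply _ (hR.measurableSet_left z)).symm
  have hW : ∀ x, ∫⁻ y in {y | R x y}, u y = ν {y | R x y} := fun z =>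
    (withDensity_apply _ (hR.measurableSet_right z)).symm
  have hVm := hR.measurable_left κ
  have hWm := hR.measurable_right ν
  have hint : ∀ g : ℝ → ℝ≥0∞, Measurable g → ∫⁻ x, g x * u x = ∫⁻ x, g x ∂ν := fun g hg => by
    rw [hνdef, lintegral_withDensity_eq_lintegral_mul _ hu hg]
    simp only [Pi.mul_apply, mul_comm]
  have hintκ : ∀ g : ℝ → ℝ≥0∞, Measurable g → ∫⁻ y, g y * k y ^ p' = ∫⁻ x, g x ∂κ := fun g hg => by
    rw [hκdef, lintegral_withDensity_eq_lintegral_mul _ hkp hg]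
    simp only [Pi.mul_apply, mul_comm]
  have hintκ' : ∀ g : ℝ → ℝ≥0∞, Measurable g → ∀ s, MeasurableSet s →
      ∫⁻ y in s, g y * k y ^ p' = ∫⁻ x in s, g x ∂κ := fun g hg s hs => by
    rw [hκdef, restrict_withDensity hs, lintegral_withDensity_eq_lintegral_mul _ hkp hg]
    simp only [Pi.mul_apply, mul_comm]
  simp only [hV, hW]
  set G : ℝ → ℝ≥0∞ := fun x => κ {y | R y x} ^ (r / p') * ν {y | R x y} ^ (r / p) with hG
  have hGm : Measurable G := (hVm.pow_const _).mul (hWm.pow_const _)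
  rw [hint G hGm]
  set I := ∫⁻ x, G x ∂ν with hI
  have hItop : I ≠ ⊤ := by
    refine ne_top_of_le_ne_top ?_ (lintegral_mono (g := fun _ =>
      κ univ ^ (r / p') * ν univ ^ (r / p)) fun x => ?_)
    · rw [lintegral_const]
      refine ENNReal.mul_ne_top (ENNReal.mul_ne_top ?_ ?_) (measure_ne_top _ _) <;>
      exact ENNReal.rpow_ne_top_of_nonneg (by positivity) (measure_ne_top _ _)
    · simp only [hG]
      gcongr <;> exact subset_univ _
  set h : ℝ → ℝ≥0∞ := fun y =>
    κ {z | R z y} ^ (r / p' / q - 1) * ν {z | R y z} ^ (r / p / q) with hh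
  have hhm : Measurable h := (hVm.pow_const _).mul (hWm.pow_const _)
  set f : ℝ → ℝ≥0∞ := fun y => h y * k y ^ (p' - 1) with hf
  have hfm : Measurable f := hhm.mul (hk.pow_const _)
  have hp'1 : 0 < p' - 1 := by linarith [hpp.symm.lt]
  have hfk : ∀ y, f y * k y = h y * k y ^ p' := fun y => by
    have : k y ^ (p' - 1) * k y = k y ^ p' := by
      nth_rw 2 [← ENNReal.rpow_one (k y)]
      rw [← ENNReal.rpow_add_of_nonneg _ _ hp'1.le zero_le_one, sub_add_cancel]
    rw [hf, mul_assoc, this]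
  have ex1 : (r / p' / q - 1) * p = r / p' - 1 := by
    have h2 : 0 < p - q := by linarith
    have h1 : 0 < p - 1 := by linarith
    rw [hr, hp']; field_simp; ring
  have ex2 : r / p / q * p = r / p + 1 := by
    rw [hbr]; field_simp
  have ex3 : (p' - 1) * p = p' := by
    have h1 : p - 1 ≠ 0 := by linarith
    rw [hp']; field_simp; ring
  have hfp : ∀ y, f y ^ p =
      κ {z | R z y} ^ (r / p' - 1) * ν {z | R y z} ^ (r / p + 1) * k y ^ p' := fun y => by
    simp only [hf, hh]
    rw [ENNReal.mul_rpow_of_nonneg _ _ hp0.le, ENNReal.mul_rpow_of_nonneg _ _ hp0.le,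
      ← ENNReal.rpow_mul, ← ENNReal.rpow_mul, ← ENNReal.rpow_mul, ex1, ex2, ex3]
  have hnorm : ∫⁻ y, f y ^ p ≤ 2 ^ (r / p + 1) * C₂ * I := by
    have hm1 : Measurable fun y => κ {z | R z y} ^ (r / p' - 1) * ν {z | R y z} ^ (r / p + 1) :=
      (hVm.pow_const _).mul (hWm.pow_const _)
    simp only [hfp]
    rw [hintκ _ hm1]
    have hWle : ∀ y, ν {z | R y z} ^ (r / p + 1) ≤
        2 ^ (r / p + 1) * ∫⁻ t in {t | R y t}, ν {z | R t z} ^ (r / p) ∂ν := fun y => by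
      have := hR'.rpow_le_lintegral (ρ := ν.restrict {t | R y t})
        (Measure.restrict_le_self.absolutelyContinuous.trans hν) (b := r / p) (by positivity)
      rwa [hR'.lintegral_restrict_section, Measure.restrict_apply_univ] at this
    have hVle : ∀ t, ∫⁻ y in {y | R y t}, κ {z | R z y} ^ (r / p' - 1) ∂κ ≤
        C₂ * κ {y | R y t} ^ (r / p') := fun t => by
      have := hup (κ.restrict {y | R y t})
        (Measure.restrict_le_self.absolutelyContinuous.trans hκ)
      rwa [hR.lintegral_restrict_section, Measure.restrict_apply_univ] at this
    have hVm1 : Measurable fun y => κ {z | R z y} ^ (r / p' - 1) := hVm.pow_const _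
    have hWm1 : Measurable fun y => ν {z | R y z} ^ (r / p) := hWm.pow_const _
    set K : ℝ → ℝ → ℝ≥0∞ := fun y t => {z : ℝ × ℝ | R z.1 z.2}.indicator
      (fun z => κ {x | R x z.1} ^ (r / p' - 1) * ν {x | R z.2 x} ^ (r / p)) (y, t) with hK
    have hKm : Measurable (Function.uncurry K) := by
      refine Measurable.indicator ?_ hR.measurable_rel
      exact (hVm1.comp measurable_fst).mul (hWm1.comp measurable_snd)
    have hK1 : ∀ y, ∫⁻ t, K y t ∂ν = κ {z | R z y} ^ (r / p' - 1) *
        ∫⁻ t in {t | R y t}, ν {z | R t z} ^ (r / p) ∂ν := fun y => by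
      rw [← lintegral_const_mul _ hWm1, ← lintegral_indicator (hR.measurableSet_right y)]
      rfl
    have hK2 : ∀ t, ∫⁻ y, K y t ∂κ = (∫⁻ y in {y | R y t}, κ {z | R z y} ^ (r / p' - 1) ∂κ) *
        ν {z | R t z} ^ (r / p) := fun t => by
      rw [← lintegral_mul_const _ hVm1, ← lintegral_indicator (hR.measurableSet_left t)]
      rfl
    calc ∫⁻ y, κ {z | R z y} ^ (r / p' - 1) * ν {z | R y z} ^ (r / p + 1) ∂κ
        ≤ ∫⁻ y, 2 ^ (r / p + 1) * ∫⁻ t, K y t ∂ν ∂κ := by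
          refine lintegral_mono fun y => ?_
          simp only
          rw [hK1, mul_left_comm]
          gcongr
          exact hWle y
      _ = 2 ^ (r / p + 1) * ∫⁻ t, ∫⁻ y, K y t ∂κ ∂ν := by
          have hKm' : Measurable fun y => ∫⁻ t, K y t ∂ν := hKm.lintegral_prod_right'
          rw [lintegral_const_mul _ hKm', lintegral_lintegral_swap hKm.aemeasurable]
      _ ≤ 2 ^ (r / p + 1) * ∫⁻ t, C₂ * G t ∂ν := by
          gcongr with t
          rw [hK2, hG]
          simp only
          rw [← mul_assoc]
          gcongr
          exact hVle t
      _ = _ := by rw [lintegral_const_mul _ hGm]; ring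
  have hlow : ∀ x, G x ≤ 2 ^ (r / p') * (∫⁻ y in {y | R y x}, f y * k y) ^ q := by
    intro x
    have h1 : κ {y | R y x} ^ (r / p' / q) ≤
        2 ^ (r / p' / q) * ∫⁻ y in {y | R y x}, κ {z | R z y} ^ (r / p' / q - 1) ∂κ := by
      have := hR.rpow_le_lintegral_of_finite (ρ := κ.restrict {y | R y x})
        (Measure.restrict_le_self.absolutelyContinuous.trans hκ) (s := r / p' / q) (by positivity)
      rwa [hR.lintegral_restrict_section, Measure.restrict_apply_univ] at this
    have h2 : κ {y | R y x} ^ (r / p' / q) * ν {y | R x y} ^ (r / p / q) ≤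
        2 ^ (r / p' / q) * ∫⁻ y in {y | R y x}, f y * k y := by
      simp only [hfk]
      rw [hintκ' h hhm _ (hR.measurableSet_left x)]
      calc _ ≤ (2 ^ (r / p' / q) * ∫⁻ y in {y | R y x}, κ {z | R z y} ^ (r / p' / q - 1) ∂κ)
              * ν {y | R x y} ^ (r / p / q) := by gcongr
        _ = 2 ^ (r / p' / q) * ∫⁻ y in {y | R y x},
              κ {z | R z y} ^ (r / p' / q - 1) * ν {y | R x y} ^ (r / p / q) ∂κ := by
            rw [lintegral_mul_const _ (hVm.pow_const _), mul_assoc]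
        _ ≤ _ := by
            gcongr 2 ^ (r / p' / q) * ?_
            refine setLIntegral_mono' (hR.measurableSet_left x) fun y hy => ?_
            simp only [hh]
            gcongr
            exact fun hz => hR.trans _ _ _ hy hz
    have h3 := ENNReal.rpow_le_rpow h2 hq.le
    rwa [ENNReal.mul_rpow_of_nonneg _ _ hq.le, ENNReal.mul_rpow_of_nonneg _ _ hq.le,
      ← ENNReal.rpow_mul, ← ENNReal.rpow_mul, ← ENNReal.rpow_mul,
      div_mul_cancel₀ _ hq.ne', div_mul_cancel₀ _ hq.ne'] at h3
  have hfktop : ∫⁻ y, f y ^ p ≠ ⊤ := ne_top_of_le_ne_top (ENNReal.mul_ne_top (ENNReal.mul_ne_top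
    (ENNReal.rpow_ne_top_of_nonneg (by positivity) (by simp)) hC₂) hItop) hnorm
  have hFm : Measurable fun x => ∫⁻ y in {y | R y x}, f y * k y :=
    hR.measurable_lintegral_left _
  have hc' := hc f hfm hfktop
  rw [hint _ (hFm.pow_const q)] at hc'
  have hmain : I ≤ 2 ^ (r / p') * (2 ^ (r / p + 1) * C₂) ^ (q / p) * c * I ^ (q / p) := by
    calc I ≤ ∫⁻ x, 2 ^ (r / p') * (∫⁻ y in {y | R y x}, f y * k y) ^ q ∂ν := lintegral_mono hlow
      _ = 2 ^ (r / p') * ∫⁻ x, (∫⁻ y in {y | R y x}, f y * k y) ^ q ∂ν :=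
          lintegral_const_mul _ (hFm.pow_const q)
      _ ≤ 2 ^ (r / p') * (c * (2 ^ (r / p + 1) * C₂ * I) ^ (q / p)) := by
          gcongr
          exact hc'.trans (by gcongr)
      _ = _ := by rw [ENNReal.mul_rpow_of_nonneg _ I (by positivity)]; ring
  by_cases hI0 : I = 0
  · rw [hI0, ENNReal.zero_rpow_of_pos (by positivity)]; exact zero_le
  · have hsum : q / r + q / p = 1 := by
      have := hpr.inv_add_inv_eq_one
      rw [inv_div, inv_div] at this; linarith
    have hI1 : I = I ^ (q / r) * I ^ (q / p) := by
      rw [← ENNReal.rpow_add _ _ hI0 hItop, hsum, ENNReal.rpow_one]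
    have hpos : I ^ (q / p) ≠ 0 := by simp [ENNReal.rpow_eq_zero_iff, hI0, hItop]
    have htop : I ^ (q / p) ≠ ⊤ := ENNReal.rpow_ne_top_of_nonneg (by positivity) hItop
    nth_rw 1 [hI1] at hmain
    exact (ENNReal.mul_le_mul_iff_left hpos htop).1 hmain

/-- Necessity of the integral condition for Hardy's inequality below the diagonal. -/
theorem hardy_ge (hR : ContinuousOrder R) (hR' : ContinuousOrder fun x y => R y x)
    {p q p' r : ℝ} (hp : 1 < p) (hq : 0 < q) (hqp : q < p)
    (hp' : p' = p / (p - 1)) (hr : r = p * q / (p - q)) :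
    ∃ C : ℝ≥0∞, C ≠ ⊤ ∧ ∀ k u : ℝ → ℝ≥0∞, Measurable k → Measurable u →
      (∀ y, k y ≠ ⊤) → (∀ y, u y ≠ ⊤) → ∀ c : ℝ≥0∞,
      (∀ f : ℝ → ℝ≥0∞, Measurable f → ∫⁻ y, f y ^ p ≠ ⊤ →
        ∫⁻ x, (∫⁻ y in {y | R y x}, f y * k y) ^ q * u x ≤ c * (∫⁻ y, f y ^ p) ^ (q / p)) →
      (∫⁻ x, (∫⁻ y in {y | R y x}, k y ^ p') ^ (r / p') * (∫⁻ y in {y | R x y}, u y) ^ (r / p)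
        * u x) ^ (q / r) ≤ C * c := by
  obtain ⟨hp'0, hr0, hbr, hpp, hpr⟩ := hardy_exponents hp hq hqp hp' hr
  have hp0 : 0 < p := by linarith
  obtain ⟨C, hC, hmain⟩ := hR.hardy_ge_of_finite hR' hp hq hqp hp' hr
  refine ⟨C, hC, fun k u hk hu hktop hutop c hc => ?_⟩
  set A : ℕ → Set ℝ := fun n => {x | x ∈ Icc (-(n : ℝ)) n ∧ k x ≤ n ∧ u x ≤ n} with hAdef
  have hAm : ∀ n, MeasurableSet (A n) := fun n =>
    measurableSet_Icc.inter ((measurableSet_le hk measurable_const).inter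
      (measurableSet_le hu measurable_const))
  have hAmono : Monotone A := by
    intro m n hmn x hx
    have h1 : (m : ℝ) ≤ n := by exact_mod_cast hmn
    have h2 : (m : ℝ≥0∞) ≤ n := by exact_mod_cast hmn
    exact ⟨⟨by linarith [hx.1.1], by linarith [hx.1.2]⟩, hx.2.1.trans h2, hx.2.2.trans h2⟩
  have hAex : ∀ x, ∃ n, x ∈ A n := by
    intro x
    obtain ⟨a, ha⟩ := exists_nat_ge |x|
    obtain ⟨b, hb⟩ := ENNReal.exists_nat_gt (hktop x)
    obtain ⟨d, hd⟩ := ENNReal.exists_nat_gt (hutop x)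
    have h1 : (a : ℝ) ≤ (max a (max b d) : ℕ) := by exact_mod_cast le_max_left _ _
    have h2 : (b : ℝ≥0∞) ≤ (max a (max b d) : ℕ) := by
      exact_mod_cast (le_max_left b d).trans (le_max_right _ _)
    have h3 : (d : ℝ≥0∞) ≤ (max a (max b d) : ℕ) := by
      exact_mod_cast (le_max_right b d).trans (le_max_right _ _)
    exact ⟨max a (max b d), abs_le.1 (ha.trans h1), hb.le.trans h2, hd.le.trans h3⟩
  have hvol : ∀ n, volume (A n) ≠ ⊤ := fun n =>
    ne_top_of_le_ne_top (by simp) (measure_mono (t := Icc (-(n : ℝ)) n) fun x hx => hx.1)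
  have hindk : ∀ n x, (A n).indicator k x ^ p' = (A n).indicator (fun y => k y ^ p') x := by
    intro n x
    by_cases h : x ∈ A n <;> simp [h, hp'0]
  have hkpm : Measurable fun y => k y ^ p' := hk.pow_const _
  have hfin1 : ∀ n, ∫⁻ y, (A n).indicator k y ^ p' ≠ ⊤ := fun n => by
    simp only [hindk]
    rw [lintegral_indicator (hAm n)]
    refine ne_top_of_le_ne_top ?_ (setLIntegral_mono' (g := fun _ => (n : ℝ≥0∞) ^ p') (hAm n)
      fun x hx => ENNReal.rpow_le_rpow hx.2.1 hp'0.le)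
    simp only [lintegral_const, Measure.restrict_apply_univ]
    exact ENNReal.mul_ne_top (ENNReal.rpow_ne_top_of_nonneg hp'0.le (by simp)) (hvol n)
  have hfin2 : ∀ n, ∫⁻ y, (A n).indicator u y ≠ ⊤ := fun n => by
    rw [lintegral_indicator (hAm n)]
    refine ne_top_of_le_ne_top ?_ (setLIntegral_mono' (g := fun _ => (n : ℝ≥0∞)) (hAm n)
      fun x hx => hx.2.2)
    simp only [lintegral_const, Measure.restrict_apply_univ]
    exact ENNReal.mul_ne_top (by simp) (hvol n)
  set J : ℕ → ℝ → ℝ≥0∞ := fun n x => (∫⁻ y in {y | R y x}, (A n).indicator k y ^ p') ^ (r / p')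
    * (∫⁻ y in {y | R x y}, (A n).indicator u y) ^ (r / p) * (A n).indicator u x with hJ
  have hbound : ∀ n, (∫⁻ x, J n x) ^ (q / r) ≤ C * c := by
    intro n
    refine hmain _ _ (hk.indicator (hAm n)) (hu.indicator (hAm n)) (hfin1 n) (hfin2 n) c ?_
    intro f hf hftop
    refine le_trans (lintegral_mono fun x => ?_) (hc f hf hftop)
    gcongr <;> exact indicator_le_self _ _ _
  have hind_mono : ∀ g : ℝ → ℝ≥0∞, ∀ x, Monotone fun n => (A n).indicator g x := fun g x m n h =>
    indicator_le_indicator_of_subset (hAmono h) (fun _ => zero_le) x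
  have hVmono : ∀ x, Monotone fun n =>
      (∫⁻ y in {y | R y x}, (A n).indicator k y ^ p') ^ (r / p') := fun x m n h => by
    simp only
    gcongr with y
    exact hAmono h
  have hWmono : ∀ x, Monotone fun n =>
      (∫⁻ y in {y | R x y}, (A n).indicator u y) ^ (r / p) := fun x m n h => by
    simp only
    gcongr with y
    exact hAmono h
  have hJmono : Monotone J := fun m n h x =>
    mul_le_mul' (mul_le_mul' (hVmono x h) (hWmono x h)) (hind_mono u x h)
  have hJm : ∀ n, Measurable (J n) := fun n =>
    (((hR.measurable_lintegral_left _).pow_const _).mul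
      ((hR.measurable_lintegral_right _).pow_const _)).mul (hu.indicator (hAm n))
  have hsup : ∀ x, (∫⁻ y in {y | R y x}, k y ^ p') ^ (r / p')
      * (∫⁻ y in {y | R x y}, u y) ^ (r / p) * u x ≤ ⨆ n, J n x := by
    intro x
    rw [← iSup_lintegral_indicator hAm hAmono hAex hkpm,
      ← iSup_lintegral_indicator hAm hAmono hAex hu, iSup_rpow_eq _ (by positivity),
      iSup_rpow_eq _ (by positivity), ← iSup_indicator_eq hAex u x]
    simp only [← hindk]
    refine le_trans (mul_le_mul_left (iSup_mul_iSup_le_of_monotone (hVmono x) (hWmono x)) _) ?_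
    exact iSup_mul_iSup_le_of_monotone ((hVmono x).mul' (hWmono x)) (hind_mono u x)
  calc _ ≤ (∫⁻ x, ⨆ n, J n x) ^ (q / r) := by
        gcongr with x
        exact hsup x
    _ = ⨆ n, (∫⁻ x, J n x) ^ (q / r) := by
        rw [lintegral_iSup hJm hJmono, iSup_rpow_eq _ (by positivity)]
    _ ≤ C * c := iSup_le hbound

end ContinuousOrder

/-- The weight `v`, restricted to the half-line. -/
def lowerKernel (v : ℝ → ℝ) : ℝ → ℝ≥0∞ := (Ioi (0:ℝ)).indicator fun y => ENNReal.ofReal (v y)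

/-- The weight `y ^ (-λ) v(y)`, restricted to the half-line. -/
def upperKernel (lam : ℝ) (v : ℝ → ℝ) : ℝ → ℝ≥0∞ :=
  (Ioi (0:ℝ)).indicator fun y => ENNReal.ofReal y ^ (-lam) * ENNReal.ofReal (v y)

/-- The Stieltjes-type integral `∫_0^∞ φ(y) v(y)/(x^λ + y^λ) dy`. -/
def stieltjes (lam : ℝ) (v : ℝ → ℝ) (φ : ℝ → ℝ≥0∞) (x : ℝ) : ℝ≥0∞ :=
  ∫⁻ y in Ioi (0:ℝ), φ y * ENNReal.ofReal (v y)
    / (ENNReal.ofReal (x ^ lam) + ENNReal.ofReal (y ^ lam))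

section Kernels

variable {lam : ℝ} {v w : ℝ → ℝ}

lemma measurable_lowerKernel (hv : Measurable v) : Measurable (lowerKernel v) :=
  hv.ennreal_ofReal.indicator measurableSet_Ioi

lemma measurable_upperKernel (hv : Measurable v) : Measurable (upperKernel lam v) :=
  ((ENNReal.measurable_ofReal.pow_const _).mul hv.ennreal_ofReal).indicator measurableSet_Ioi

lemma lowerKernel_ne_top (y : ℝ) : lowerKernel v y ≠ ⊤ := by
  by_cases hy : y ∈ Ioi (0:ℝ) <;> simp [lowerKernel, hy]

lemma upperKernel_ne_top (y : ℝ) : upperKernel lam v y ≠ ⊤ := by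
  by_cases hy : y ∈ Ioi (0:ℝ)
  · rw [upperKernel, indicator_of_mem hy, ENNReal.ofReal_rpow_of_pos hy]
    exact ENNReal.mul_ne_top ENNReal.ofReal_ne_top ENNReal.ofReal_ne_top
  · simp [upperKernel, hy]

lemma lowerKernel_of_pos {y : ℝ} (hy : 0 < y) : lowerKernel v y = ENNReal.ofReal (v y) :=
  indicator_of_mem (s := Ioi (0:ℝ)) hy _

lemma upperKernel_of_pos {y : ℝ} (hy : 0 < y) :
    upperKernel lam v y = ENNReal.ofReal y ^ (-lam) * ENNReal.ofReal (v y) :=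
  indicator_of_mem (s := Ioi (0:ℝ)) hy _

lemma lowerKernel_of_nonpos {y : ℝ} (hy : ¬ 0 < y) : lowerKernel v y = 0 :=
  indicator_of_notMem (s := Ioi (0:ℝ)) hy _

lemma upperKernel_of_nonpos {y : ℝ} (hy : ¬ 0 < y) : upperKernel lam v y = 0 :=
  indicator_of_notMem (s := Ioi (0:ℝ)) hy _

lemma upperKernel_rpow {y s : ℝ} (hy : 0 < y) (hs : 0 < s) :
    upperKernel lam v y ^ s = ENNReal.ofReal y ^ (-(lam * s)) * ENNReal.ofReal (v y) ^ s := by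
  rw [upperKernel_of_pos hy, ENNReal.mul_rpow_of_nonneg _ _ hs.le, ← ENNReal.rpow_mul, neg_mul]

lemma lintegral_lowerKernel_rpow {s : ℝ} (hs : 0 < s) (x : ℝ) :
    ∫⁻ y in {y | y < x}, lowerKernel v y ^ s = V0 s v x := by
  have h : ∀ y, lowerKernel v y ^ s
      = (Ioi (0:ℝ)).indicator (fun y => ENNReal.ofReal (v y) ^ s) y := fun y => by
    by_cases hy : y ∈ Ioi (0:ℝ)
    · rw [indicator_of_mem hy, lowerKernel_of_pos hy]
    · rw [indicator_of_notMem hy, lowerKernel_of_nonpos hy, ENNReal.zero_rpow_of_pos hs]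
  simp_rw [h]
  rw [setLIntegral_indicator measurableSet_Ioi]
  rfl

lemma lintegral_upperKernel_rpow {s x : ℝ} (hs : 0 < s) (hx : 0 < x) :
    ∫⁻ y in {y | x < y}, upperKernel lam v y ^ s = Vinf lam s v x :=
  setLIntegral_congr_fun measurableSet_Ioi fun _ hy => upperKernel_rpow (hx.trans hy) hs

lemma lintegral_eq_of_nonpos_eq_zero {g h : ℝ → ℝ≥0∞} (hg : ∀ x, ¬ 0 < x → g x = 0)
    (hgh : ∀ x, 0 < x → g x = h x) : ∫⁻ x, g x = ∫⁻ x in Ioi (0:ℝ), h x := by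
  rw [← lintegral_indicator measurableSet_Ioi]
  refine lintegral_congr fun x => ?_
  by_cases hx : x ∈ Ioi (0:ℝ)
  · rw [indicator_of_mem hx, hgh x hx]
  · rw [indicator_of_notMem hx, hg x hx]

lemma BH_eq {p p' q r : ℝ} (hp' : 0 < p') (hq : 0 < q) :
    BH lam p p' q r v w = (∫⁻ x, (∫⁻ y in {y | y < x}, lowerKernel v y ^ p') ^ (r / p')
      * (∫⁻ y in {y | x < y}, upperKernel lam w y ^ q) ^ (r / p)
      * upperKernel lam w x ^ q) ^ (1 / r) := by
  rw [BH]
  congr 1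
  symm
  refine lintegral_eq_of_nonpos_eq_zero (fun x hx => ?_) fun x hx => ?_
  · rw [upperKernel_of_nonpos hx, ENNReal.zero_rpow_of_pos hq, mul_zero]
  · rw [lintegral_lowerKernel_rpow hp', lintegral_upperKernel_rpow hq hx, upperKernel_rpow hx hq,
      ← mul_assoc]
    rfl

lemma BHs_eq {p p' q r : ℝ} (hp' : 0 < p') (hq : 0 < q) :
    BHs lam p p' q r v w = (∫⁻ x, (∫⁻ y in {y | x < y}, upperKernel lam v y ^ p') ^ (r / p')
      * (∫⁻ y in {y | y < x}, lowerKernel w y ^ q) ^ (r / p)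
      * lowerKernel w x ^ q) ^ (1 / r) := by
  rw [BHs]
  congr 1
  symm
  refine lintegral_eq_of_nonpos_eq_zero (fun x hx => ?_) fun x hx => ?_
  · rw [lowerKernel_of_nonpos hx, ENNReal.zero_rpow_of_pos hq, mul_zero]
  · rw [lintegral_lowerKernel_rpow hq, lintegral_upperKernel_rpow hp' hx, lowerKernel_of_pos hx]
    rfl

lemma ofReal_rpow_neg {x : ℝ} (hx : 0 < x) :
    ENNReal.ofReal x ^ (-lam) = (ENNReal.ofReal (x ^ lam))⁻¹ := by
  rw [ENNReal.rpow_neg, ENNReal.ofReal_rpow_of_pos hx]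

lemma inv_le_two_mul_inv_add {a b : ℝ≥0∞} (h : b ≤ a) : a⁻¹ ≤ 2 * (a + b)⁻¹ := by
  calc a⁻¹ = 2 * (2 * a)⁻¹ := by
        rw [ENNReal.mul_inv (by simp) (by simp), ← mul_assoc,
          ENNReal.mul_inv_cancel (by simp) (by simp), one_mul]
    _ ≤ 2 * (a + b)⁻¹ := by
        gcongr
        rw [two_mul]
        gcongr

lemma measurable_stieltjes_integrand (hv : Measurable v) {φ : ℝ → ℝ≥0∞} (hφ : Measurable φ)
    (x : ℝ) : Measurable fun y => φ y * ENNReal.ofReal (v y)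
      / (ENNReal.ofReal (x ^ lam) + ENNReal.ofReal (y ^ lam)) := by
  fun_prop

lemma stieltjes_le (hv : Measurable v) {φ : ℝ → ℝ≥0∞} (hφ : Measurable φ) {x : ℝ} (hx : 0 < x) :
    stieltjes lam v φ x ≤ ENNReal.ofReal x ^ (-lam) * (∫⁻ y in {y | y < x}, φ y * lowerKernel v y)
      + ∫⁻ y in {y | x < y}, φ y * upperKernel lam v y := by
  have hm : Measurable fun y => φ y * lowerKernel v y := hφ.mul (measurable_lowerKernel hv)
  rw [stieltjes, ← lintegral_indicator measurableSet_Ioi,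
    ← lintegral_add_compl _ (measurableSet_Iic (a := x)), compl_Iic,
    setLIntegral_congr Iio_ae_eq_Iic.symm,
    ← lintegral_const_mul _ hm]
  refine add_le_add (setLIntegral_mono (hm.const_mul _) fun y hy => ?_)
    (setLIntegral_mono (hφ.mul (measurable_upperKernel hv)) fun y hy => ?_)
  · by_cases hy0 : 0 < y
    · rw [indicator_of_mem (s := Ioi (0:ℝ)) hy0, lowerKernel_of_pos hy0, ofReal_rpow_neg hx,
        div_eq_mul_inv, mul_comm]
      gcongr
      exact le_self_add
    · rw [indicator_of_notMem (s := Ioi (0:ℝ)) hy0]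
      exact zero_le
  · have hy0 : 0 < y := hx.trans hy
    rw [indicator_of_mem (s := Ioi (0:ℝ)) hy0, upperKernel_of_pos hy0, ofReal_rpow_neg hy0,
        div_eq_mul_inv, mul_comm _⁻¹ (ENNReal.ofReal (v y)), ← mul_assoc]
    gcongr
    exact le_add_self

lemma lower_le_stieltjes (hlam : 0 < lam) (hv : Measurable v) {φ : ℝ → ℝ≥0∞} (hφ : Measurable φ)
    {x : ℝ} (hx : 0 < x) :
    ENNReal.ofReal x ^ (-lam) * ∫⁻ y in {y | y < x}, φ y * lowerKernel v y
      ≤ 2 * stieltjes lam v φ x := by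
  have hm : Measurable fun y => φ y * lowerKernel v y := hφ.mul (measurable_lowerKernel hv)
  have hS := measurable_stieltjes_integrand (lam := lam) hv hφ x
  rw [stieltjes, ← lintegral_indicator measurableSet_Ioi, ← lintegral_const_mul _ hm,
    ← lintegral_const_mul _ (hS.indicator measurableSet_Ioi)]
  refine le_trans (setLIntegral_mono ((hS.indicator measurableSet_Ioi).const_mul _)
    fun y hy => ?_) (setLIntegral_le_lintegral {y | y < x} _)
  by_cases hy0 : 0 < y
  · rw [indicator_of_mem (s := Ioi (0:ℝ)) hy0, lowerKernel_of_pos hy0, ofReal_rpow_neg hx,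
      div_eq_mul_inv, mul_comm, mul_left_comm]
    gcongr
    exact inv_le_two_mul_inv_add
      (ENNReal.ofReal_le_ofReal (Real.rpow_le_rpow hy0.le (le_of_lt hy) hlam.le))
  · rw [lowerKernel_of_nonpos hy0, mul_zero, mul_zero]
    exact zero_le

lemma upper_le_stieltjes (hlam : 0 < lam) (hv : Measurable v) {φ : ℝ → ℝ≥0∞} (hφ : Measurable φ)
    {x : ℝ} (hx : 0 < x) :
    ∫⁻ y in {y | x < y}, φ y * upperKernel lam v y ≤ 2 * stieltjes lam v φ x := by
  have hS := measurable_stieltjes_integrand (lam := lam) hv hφ x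
  rw [stieltjes, ← lintegral_const_mul _ hS]
  refine le_trans (setLIntegral_mono (hS.const_mul _) fun y hy => ?_)
    (lintegral_mono_set (Ioi_subset_Ioi hx.le))
  have hy0 : 0 < y := hx.trans hy
  rw [upperKernel_of_pos hy0, ofReal_rpow_neg hy0, div_eq_mul_inv,
    mul_comm _ (ENNReal.ofReal (v y)), ← mul_assoc, mul_left_comm, add_comm]
  gcongr
  exact inv_le_two_mul_inv_add
    (ENNReal.ofReal_le_ofReal (Real.rpow_le_rpow hx.le (le_of_lt hy) hlam.le))

end Kernels

section Bounds

variable {lam p q p' r : ℝ} {v w : ℝ → ℝ}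

lemma add_rpow_le_two_rpow_mul (hq : 0 < q) (a b : ℝ≥0∞) :
    (a + b) ^ q ≤ 2 ^ q * (a ^ q + b ^ q) := by
  rw [mul_add, ← ENNReal.mul_rpow_of_nonneg _ _ hq.le, ← ENNReal.mul_rpow_of_nonneg _ _ hq.le]
  rcases le_total a b with h | h
  · refine le_trans (ENNReal.rpow_le_rpow ?_ hq.le) le_add_self
    rw [two_mul]
    gcongr
  · refine le_trans (ENNReal.rpow_le_rpow ?_ hq.le) le_self_add
    rw [two_mul]
    gcongr

/-- The constant in the two-weight Hardy inequality. -/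
def hardyConst (p q : ℝ) : ℝ≥0∞ := 2 * 4 ^ q * 2 ^ (q / p)

lemma lintegral_lower_le (hp : 1 < p) (hq : 0 < q) (hqp : q < p) (hp' : p' = p / (p - 1))
    (hr : r = p * q / (p - q)) (hv : Measurable v) (hw : Measurable w) {φ : ℝ → ℝ≥0∞}
    (hφ : Measurable φ) :
    ∫⁻ x, (∫⁻ y in {y | y < x}, φ y * lowerKernel v y) ^ q * upperKernel lam w x ^ q
      ≤ hardyConst p q * BH lam p p' q r v w ^ q * (∫⁻ y, φ y ^ p) ^ (q / p) := by
  have hp'0 := (hardy_exponents hp hq hqp hp' hr).1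
  rw [BH_eq hp'0 hq, ← ENNReal.rpow_mul, one_div_mul_eq_div]
  exact continuousOrder_lt.hardy_le continuousOrder_gt hp hq hqp hp' hr hφ
    (measurable_lowerKernel hv) ((measurable_upperKernel hw).pow_const _)

lemma lintegral_upper_le (hp : 1 < p) (hq : 0 < q) (hqp : q < p) (hp' : p' = p / (p - 1))
    (hr : r = p * q / (p - q)) (hv : Measurable v) (hw : Measurable w) {φ : ℝ → ℝ≥0∞}
    (hφ : Measurable φ) :
    ∫⁻ x, (∫⁻ y in {y | x < y}, φ y * upperKernel lam v y) ^ q * lowerKernel w x ^ q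
      ≤ hardyConst p q * BHs lam p p' q r v w ^ q * (∫⁻ y, φ y ^ p) ^ (q / p) := by
  have hp'0 := (hardy_exponents hp hq hqp hp' hr).1
  rw [BHs_eq hp'0 hq, ← ENNReal.rpow_mul, one_div_mul_eq_div]
  exact continuousOrder_gt.hardy_le continuousOrder_lt hp hq hqp hp' hr hφ
    (measurable_upperKernel hv) ((measurable_lowerKernel hw).pow_const _)

lemma lintegral_stieltjes_le (hp : 1 < p) (hq : 0 < q) (hqp : q < p) (hp' : p' = p / (p - 1))
    (hr : r = p * q / (p - q)) (hv : Measurable v) (hw : Measurable w) {φ : ℝ → ℝ≥0∞}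
    (hφ : Measurable φ) :
    ∫⁻ x in Ioi (0:ℝ), (ENNReal.ofReal (w x) * stieltjes lam v φ x) ^ q
      ≤ 2 ^ q * (2 * hardyConst p q) * (BH lam p p' q r v w + BHs lam p p' q r v w) ^ q
        * (∫⁻ y, φ y ^ p) ^ (q / p) := by
  have hm₁ : Measurable fun x =>
      (∫⁻ y in {y | y < x}, φ y * lowerKernel v y) ^ q * upperKernel lam w x ^ q :=
    ((continuousOrder_lt.measurable_lintegral_left _).pow_const _).mul
      ((measurable_upperKernel hw).pow_const _)
  have hm₂ : Measurable fun x =>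
      (∫⁻ y in {y | x < y}, φ y * upperKernel lam v y) ^ q * lowerKernel w x ^ q :=
    ((continuousOrder_gt.measurable_lintegral_left _).pow_const _).mul
      ((measurable_lowerKernel hw).pow_const _)
  have hpt : ∀ x ∈ Ioi (0:ℝ), (ENNReal.ofReal (w x) * stieltjes lam v φ x) ^ q ≤
      2 ^ q * ((∫⁻ y in {y | y < x}, φ y * lowerKernel v y) ^ q * upperKernel lam w x ^ q
        + (∫⁻ y in {y | x < y}, φ y * upperKernel lam v y) ^ q * lowerKernel w x ^ q) := by
    intro x hx
    rw [← ENNReal.mul_rpow_of_nonneg _ _ hq.le, ← ENNReal.mul_rpow_of_nonneg _ _ hq.le]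
    refine le_trans (ENNReal.rpow_le_rpow ?_ hq.le) (add_rpow_le_two_rpow_mul hq _ _)
    rw [upperKernel_of_pos hx, lowerKernel_of_pos hx]
    refine (mul_le_mul_right (stieltjes_le hv hφ hx) _).trans (le_of_eq ?_)
    ring
  calc ∫⁻ x in Ioi (0:ℝ), (ENNReal.ofReal (w x) * stieltjes lam v φ x) ^ q
      ≤ ∫⁻ x, 2 ^ q * ((∫⁻ y in {y | y < x}, φ y * lowerKernel v y) ^ q * upperKernel lam w x ^ q
        + (∫⁻ y in {y | x < y}, φ y * upperKernel lam v y) ^ q * lowerKernel w x ^ q) :=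
        (setLIntegral_mono ((hm₁.add hm₂).const_mul _) hpt).trans
          (setLIntegral_le_lintegral _ _)
    _ ≤ 2 ^ q * (hardyConst p q * BH lam p p' q r v w ^ q * (∫⁻ y, φ y ^ p) ^ (q / p)
          + hardyConst p q * BHs lam p p' q r v w ^ q * (∫⁻ y, φ y ^ p) ^ (q / p)) := by
        rw [lintegral_const_mul' _ _ (ENNReal.rpow_ne_top_of_nonneg hq.le (by simp)),
          lintegral_add_left hm₁]
        gcongr
        · exact lintegral_lower_le hp hq hqp hp' hr hv hw hφ
        · exact lintegral_upper_le hp hq hqp hp' hr hv hw hφ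
    _ ≤ 2 ^ q * (hardyConst p q * (BH lam p p' q r v w + BHs lam p p' q r v w) ^ q
            * (∫⁻ y, φ y ^ p) ^ (q / p)
          + hardyConst p q * (BH lam p p' q r v w + BHs lam p p' q r v w) ^ q
            * (∫⁻ y, φ y ^ p) ^ (q / p)) := by
        gcongr
        · exact le_self_add
        · exact le_add_self
    _ = _ := by ring

lemma SNorm_le (hp : 1 < p) (hq : 0 < q) (hqp : q < p) (hp' : p' = p / (p - 1))
    (hr : r = p * q / (p - q)) (hv : Measurable v) (hw : Measurable w) :
    SNorm lam p q v w ≤ (2 ^ q * (2 * hardyConst p q)) ^ (1 / q)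
      * (BH lam p p' q r v w + BHs lam p p' q r v w) := by
  refine sInf_le fun f hf _ => ?_
  have hp0 : 0 < p := by linarith
  set φ : ℝ → ℝ≥0∞ := (Ioi (0:ℝ)).indicator fun y => ENNReal.ofReal (f y) with hφdef
  have hφ : Measurable φ := hf.ennreal_ofReal.indicator measurableSet_Ioi
  have hφf : ∀ y, 0 < y → φ y = ENNReal.ofReal (f y) := fun y hy =>
    indicator_of_mem (s := Ioi (0:ℝ)) hy _
  have hS : ∀ x, stieltjes lam v φ x = ∫⁻ y in Ioi (0:ℝ), ENNReal.ofReal (f y)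
      * ENNReal.ofReal (v y) / (ENNReal.ofReal (x ^ lam) + ENNReal.ofReal (y ^ lam)) := fun x =>
    setLIntegral_congr_fun measurableSet_Ioi fun y hy => by simp only [hφf y hy]
  have hN : ∫⁻ y, φ y ^ p = ∫⁻ y in Ioi (0:ℝ), ENNReal.ofReal (f y) ^ p := by
    refine lintegral_eq_of_nonpos_eq_zero (fun y hy => ?_) fun y hy => by rw [hφf y hy]
    rw [hφdef, indicator_of_notMem (s := Ioi (0:ℝ)) hy, ENNReal.zero_rpow_of_pos hp0]
  have key := lintegral_stieltjes_le (lam := lam) hp hq hqp hp' hr hv hw hφ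
  simp_rw [hS] at key
  rw [hN] at key
  refine (ENNReal.rpow_le_rpow key (by positivity : 0 ≤ 1 / q)).trans (le_of_eq ?_)
  rw [ENNReal.mul_rpow_of_nonneg _ _ (by positivity),
    ENNReal.mul_rpow_of_nonneg _ _ (by positivity),
    ← ENNReal.rpow_mul, ← ENNReal.rpow_mul, mul_one_div_cancel hq.ne', ENNReal.rpow_one]
  congr 2
  field_simp

/-- A constant admissible for real-valued functions is admissible for `ℝ≥0∞`-valued functions of
finite norm. -/
lemma lintegral_stieltjes_le_of_bound (hp : 0 < p) (hq : 0 < q) {c : ℝ≥0∞}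
    (hc : ∀ f : ℝ → ℝ, Measurable f → (∀ y, 0 ≤ f y) →
      (∫⁻ x in Ioi (0:ℝ), (ENNReal.ofReal (w x)
        * stieltjes lam v (fun y => ENNReal.ofReal (f y)) x) ^ q) ^ (1/q)
      ≤ c * (∫⁻ y in Ioi (0:ℝ), ENNReal.ofReal (f y) ^ p) ^ (1/p))
    {φ : ℝ → ℝ≥0∞} (hφ : Measurable φ) (hfin : ∫⁻ y, φ y ^ p ≠ ⊤) :
    ∫⁻ x in Ioi (0:ℝ), (ENNReal.ofReal (w x) * stieltjes lam v φ x) ^ q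
      ≤ c ^ q * (∫⁻ y, φ y ^ p) ^ (q / p) := by
  have hae : ∀ᵐ y, ENNReal.ofReal (φ y).toReal = φ y := by
    filter_upwards [ae_lt_top (hφ.pow_const p) hfin] with y hy
    refine ENNReal.ofReal_toReal fun h => ?_
    rw [h, ENNReal.top_rpow_of_pos hp] at hy
    exact lt_irrefl _ hy
  have hS : ∀ x,
      stieltjes lam v (fun y => ENNReal.ofReal (φ y).toReal) x = stieltjes lam v φ x := by
    intro x
    refine lintegral_congr_ae (ae_restrict_of_ae ?_)
    filter_upwards [hae] with y hy
    rw [hy]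
  have hN : ∫⁻ y in Ioi (0:ℝ), ENNReal.ofReal (φ y).toReal ^ p ≤ ∫⁻ y, φ y ^ p := by
    refine (setLIntegral_le_lintegral _ _).trans (le_of_eq (lintegral_congr_ae ?_))
    filter_upwards [hae] with y hy
    rw [hy]
  have key := hc (fun y => (φ y).toReal) hφ.ennreal_toReal fun y => ENNReal.toReal_nonneg
  simp_rw [hS] at key
  have key2 := ENNReal.rpow_le_rpow key hq.le
  rw [← ENNReal.rpow_mul, one_div_mul_cancel hq.ne', ENNReal.rpow_one,
    ENNReal.mul_rpow_of_nonneg _ _ hq.le, ← ENNReal.rpow_mul, one_div_mul_eq_div] at key2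
  exact key2.trans (by gcongr)

/-- Passing from a bound for the `q`-th power over the half-line to one over the real line. -/
lemma lintegral_le_of_le_two_mul (hq : 0 < q) {T k : ℝ → ℝ≥0∞} (hk : ∀ x, ¬ 0 < x → k x = 0)
    {S : ℝ → ℝ≥0∞} (h : ∀ x, 0 < x → T x * k x ≤ 2 * S x) :
    ∫⁻ x, T x ^ q * k x ^ q ≤ 2 ^ q * ∫⁻ x in Ioi (0:ℝ), S x ^ q := by
  rw [← lintegral_const_mul' _ _ (ENNReal.rpow_ne_top_of_nonneg hq.le (by simp)),
    lintegral_eq_of_nonpos_eq_zero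
      (fun x hx => by rw [hk x hx, ENNReal.zero_rpow_of_pos hq, mul_zero])
      fun x _ => rfl]
  refine setLIntegral_mono' measurableSet_Ioi fun x hx => ?_
  rw [← ENNReal.mul_rpow_of_nonneg _ _ hq.le, ← ENNReal.mul_rpow_of_nonneg _ _ hq.le]
  exact ENNReal.rpow_le_rpow (h x hx) hq.le

lemma rpow_one_div_le_of_rpow_le (hq : 0 < q) {I C c : ℝ≥0∞}
    (h : I ^ (q / r) ≤ C * (2 ^ q * c ^ q)) : I ^ (1 / r) ≤ C ^ (1 / q) * (2 * c) := by
  have h' := ENNReal.rpow_le_rpow h (by positivity : 0 ≤ 1 / q)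
  rw [← ENNReal.rpow_mul, ENNReal.mul_rpow_of_nonneg _ _ (by positivity),
    ← ENNReal.mul_rpow_of_nonneg _ _ hq.le, ← ENNReal.rpow_mul, mul_one_div_cancel hq.ne',
    ENNReal.rpow_one, div_mul_div_comm, mul_comm r q, mul_div_mul_left _ _ hq.ne'] at h'
  exact h'

lemma le_SNorm (hlam : 0 < lam) (hp : 1 < p) (hq : 0 < q) (hqp : q < p) (hp' : p' = p / (p - 1))
    (hr : r = p * q / (p - q)) :
    ∃ M : ℝ≥0∞, M ≠ 0 ∧ M ≠ ⊤ ∧ ∀ v w : ℝ → ℝ, Measurable v → Measurable w →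
      M⁻¹ * (BH lam p p' q r v w + BHs lam p p' q r v w) ≤ SNorm lam p q v w := by
  have hp0 : 0 < p := by linarith
  have hp'0 := (hardy_exponents hp hq hqp hp' hr).1
  obtain ⟨C₁, hC₁, h₁⟩ := continuousOrder_lt.hardy_ge continuousOrder_gt hp hq hqp hp' hr
  obtain ⟨C₂, hC₂, h₂⟩ := continuousOrder_gt.hardy_ge continuousOrder_lt hp hq hqp hp' hr
  have hq1 : 0 ≤ 1 / q := by positivity
  have hM : C₁ ^ (1 / q) * 2 + C₂ ^ (1 / q) * 2 + 1 ≠ ⊤ := by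
    have hfin : ∀ C : ℝ≥0∞, C ≠ ⊤ → C ^ (1 / q) * 2 ≠ ⊤ := fun C hC =>
      ENNReal.mul_ne_top (ENNReal.rpow_ne_top_of_nonneg hq1 hC) (by simp)
    exact ENNReal.add_ne_top.2 ⟨ENNReal.add_ne_top.2 ⟨hfin C₁ hC₁, hfin C₂ hC₂⟩, by simp⟩
  have hM0 : C₁ ^ (1 / q) * 2 + C₂ ^ (1 / q) * 2 + 1 ≠ 0 := by simp
  refine ⟨_, hM0, hM, fun v w hv hw => le_sInf fun c hc => ?_⟩
  rw [ENNReal.inv_mul_le_iff hM0 hM]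
  have hS := fun φ hφ hfin => lintegral_stieltjes_le_of_bound (φ := φ) hp0 hq hc hφ hfin
  have hBH : BH lam p p' q r v w ≤ C₁ ^ (1 / q) * (2 * c) := by
    rw [BH_eq hp'0 hq]
    refine rpow_one_div_le_of_rpow_le hq (h₁ _ _ (measurable_lowerKernel hv)
      ((measurable_upperKernel hw).pow_const _) lowerKernel_ne_top
      (fun y => ENNReal.rpow_ne_top_of_nonneg hq.le (upperKernel_ne_top y)) _
      fun φ hφ hfin => ?_)
    rw [mul_assoc]
    refine (lintegral_le_of_le_two_mul hq (fun x hx => upperKernel_of_nonpos hx)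
      fun x hx => ?_).trans (mul_le_mul_right (hS φ hφ hfin) _)
    rw [upperKernel_of_pos hx, mul_left_comm 2, mul_comm, mul_comm (ENNReal.ofReal x ^ (-lam)),
      mul_assoc]
    exact mul_le_mul_right (lower_le_stieltjes hlam hv hφ hx) _
  have hBHs : BHs lam p p' q r v w ≤ C₂ ^ (1 / q) * (2 * c) := by
    rw [BHs_eq hp'0 hq]
    refine rpow_one_div_le_of_rpow_le hq (h₂ _ _ (measurable_upperKernel hv)
      ((measurable_lowerKernel hw).pow_const _) upperKernel_ne_top
      (fun y => ENNReal.rpow_ne_top_of_nonneg hq.le (lowerKernel_ne_top y)) _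
      fun φ hφ hfin => ?_)
    rw [mul_assoc]
    refine (lintegral_le_of_le_two_mul hq (fun x hx => lowerKernel_of_nonpos hx)
      fun x hx => ?_).trans (mul_le_mul_right (hS φ hφ hfin) _)
    rw [lowerKernel_of_pos hx, mul_left_comm 2, mul_comm]
    exact mul_le_mul_right (upper_le_stieltjes hlam hv hφ hx) _
  calc _ ≤ C₁ ^ (1 / q) * (2 * c) + C₂ ^ (1 / q) * (2 * c) := add_le_add hBH hBHs
    _ = (C₁ ^ (1 / q) * 2 + C₂ ^ (1 / q) * 2) * c := by ring
    _ ≤ _ := mul_le_mul_left le_self_add _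

end Bounds

theorem stmt12 (lam p q : ℝ) (hlam : 0 < lam)
    (hcase : (0 < q ∧ q < 1 ∧ 1 < p) ∨ (1 < q ∧ q < p))
    (p' r : ℝ) (hp' : p' = p / (p - 1)) (hr : r = p * q / (p - q)) :
    ∃ c₁ c₂ : ℝ, 0 < c₁ ∧ c₁ ≤ c₂ ∧
      ∀ v w : ℝ → ℝ, Measurable v → Measurable w →
        (∀ y, 0 ≤ v y) → (∀ x, 0 ≤ w x) →
        LocallyIntegrableOn (fun y => v y ^ p') (Ioi (0:ℝ)) →
        LocallyIntegrableOn (fun x => w x ^ q) (Ioi (0:ℝ)) →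
        ENNReal.ofReal c₁ * (BH lam p p' q r v w + BHs lam p p' q r v w)
            ≤ SNorm lam p q v w
          ∧ SNorm lam p q v w
            ≤ ENNReal.ofReal c₂ * (BH lam p p' q r v w + BHs lam p p' q r v w)
          ∧ (SNorm lam p q v w < ⊤ ↔ BH lam p p' q r v w + BHs lam p p' q r v w < ⊤) := by
  have hp : 1 < p := by rcases hcase with h | h <;> linarith [h.2]
  have hq : 0 < q := by rcases hcase with h | h <;> linarith [h.1]
  have hqp : q < p := by rcases hcase with h | h <;> linarith [h.2]
  obtain ⟨M, hM0, hM, hlow⟩ := le_SNorm hlam hp hq hqp hp' hr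
  set K : ℝ≥0∞ := (2 ^ q * (2 * hardyConst p q)) ^ (1 / q)
  have hK : K ≠ ⊤ := by
    have hpow : ∀ a : ℝ≥0∞, a ≠ ⊤ → ∀ s : ℝ, 0 ≤ s → a ^ s ≠ ⊤ := fun a ha s hs =>
      ENNReal.rpow_ne_top_of_nonneg hs ha
    have hp0 : 0 < p := by linarith
    refine hpow _ (ENNReal.mul_ne_top (hpow _ (by simp) _ hq.le) (ENNReal.mul_ne_top (by simp)
      (ENNReal.mul_ne_top (ENNReal.mul_ne_top (by simp) (hpow _ (by simp) _ hq.le))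
        (hpow _ (by simp) _ (by positivity))))) _ (by positivity)
  have hc₁ : 0 < (M⁻¹).toReal :=
    ENNReal.toReal_pos (ENNReal.inv_ne_zero.2 hM) (ENNReal.inv_ne_top.2 hM0)
  refine ⟨(M⁻¹).toReal, max (M⁻¹).toReal K.toReal, hc₁, le_max_left _ _,
    fun v w hv hw _ _ _ _ => ?_⟩
  have h₁ := hlow v w hv hw
  have h₂ : SNorm lam p q v w ≤ ENNReal.ofReal (max (M⁻¹).toReal K.toReal)
      * (BH lam p p' q r v w + BHs lam p p' q r v w) := by
    refine (SNorm_le hp hq hqp hp' hr hv hw).trans (mul_le_mul_left ?_ _)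
    exact (ENNReal.ofReal_toReal hK).ge.trans (ENNReal.ofReal_le_ofReal (le_max_right _ _))
  rw [ENNReal.ofReal_toReal (ENNReal.inv_ne_top.2 hM0)]
  refine ⟨h₁, h₂, fun h => ?_, fun h => h₂.trans_lt (ENNReal.mul_lt_top ENNReal.ofReal_lt_top h)⟩
  rw [ENNReal.inv_mul_le_iff hM0 hM] at h₁
  exact h₁.trans_lt (ENNReal.mul_lt_top hM.lt_top h)
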